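/- Let γ ∈ (0,1) and let f : [0,1] → ℝ be a function of bounded variation. Then for every ε > 0 and every x > 0, there exists a constant C(x) > 0 such that for all n ≥ 1, ν_γ( n^{−1} |S_n(f − ν_γ(f))| > x ) ≤ C(x) n^{−(1−γ)/γ + ε}. -/

import Mathlib

open MeasureTheory ProbabilityTheory Filter Set
open scoped ENNReal NNReal Topology

noncomputable section

/-- The intermittent (Liverani–Saussol–Vaienti) map `T_γ` on `[0,1]`. -/
def Tmap (γ : ℝ) (x : ℝ) : ℝ :=
  if x < 1/2 then x * (1 + 2 ^ γ * x ^ γ) else 2 * x - 1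

/-- `K` is the Perron–Frobenius operator of `T_γ` with respect to `ν`:
`ν(f · g∘T_γ) = ν(K f · g)` for all bounded measurable `f, g`. -/
def IsPFOp (γ : ℝ) (ν : Measure ℝ) (K : (ℝ → ℝ) → ℝ → ℝ) : Prop :=
  ∀ f g : ℝ → ℝ, Measurable f → Measurable g → (∃ C, ∀ x, |f x| ≤ C) →
    (∃ C, ∀ x, |g x| ≤ C) →
    ∫ x, f x * g (Tmap γ x) ∂ν = ∫ x, (K f) x * g x ∂ν

/-- Birkhoff sums `S_n(f) = ∑_{i=1}^n f ∘ T_γ^i`. -/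
def Sn (γ : ℝ) (f : ℝ → ℝ) (n : ℕ) (x : ℝ) : ℝ :=
  ∑ i ∈ Finset.range n, f ((Tmap γ)^[i + 1] x)

/-- The class `H_{α,1}` of `α`-Hölder functions (with constant 1) on `[0,1]`. -/
def Hclass (α : ℝ) : Set (ℝ → ℝ) :=
  {f | ∀ x ∈ Set.Icc (0:ℝ) 1, ∀ y ∈ Set.Icc (0:ℝ) 1, |f x - f y| ≤ |x - y| ^ α}

/-- `f_t = 1_{(-∞, t]}`. -/
def indic (t : ℝ) : ℝ → ℝ := Set.indicator (Set.Iic t) (fun _ => 1)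

/-- Nested operator `K^{(n_1,…,n_k)}(f_1,…,f_k)
= K^{n_1}(f_1 · K^{n_2}(f_2 ⋯ K^{n_k}(f_k)⋯))`, encoded by a list of pairs. -/
def nestedK (K : (ℝ → ℝ) → ℝ → ℝ) : List (ℕ × (ℝ → ℝ)) → ℝ → ℝ
  | [] => fun _ => 1
  | (n, f) :: r => K^[n] (fun x => f x * nestedK K r x)

/-- The list `[(n, f_{t_1}), (n_2, f_{t_2}), …, (n_l, f_{t_l})]`. -/
def tList (n : ℕ) {l : ℕ} (ns : Fin l → ℕ) (ts : Fin (l + 1) → ℝ) :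
    List (ℕ × (ℝ → ℝ)) :=
  (n, indic (ts 0)) :: List.ofFn (fun i : Fin l => (ns i, indic (ts i.succ)))

/-- The coefficient `α_1(n)` for an operator `K` with invariant measure `ν`. -/
def alpha1 (K : (ℝ → ℝ) → ℝ → ℝ) (ν : Measure ℝ) (n : ℕ) : ℝ :=
  ⨆ t : ℝ, ∫ x, |K^[n] (indic t) x - ∫ y, indic t y ∂ν| ∂ν

/-- The dependence coefficient `α_k(n)`. -/
def alphaCoef (K : (ℝ → ℝ) → ℝ → ℝ) (ν : Measure ℝ) (k n : ℕ) : ℝ :=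
  max (alpha1 K ν n)
    (⨆ j : Fin (k - 1), ⨆ ns : {m : Fin (j.1 + 1) → ℕ // ∀ i, 1 ≤ m i},
      ⨆ ts : Fin (j.1 + 2) → ℝ,
        ∫ x, |nestedK K (tList n ns.1 ts) x - ∫ y, nestedK K (tList n ns.1 ts) y ∂ν| ∂ν)

/-- The dependence coefficient `β_1(n)`. -/
def beta1 (K : (ℝ → ℝ) → ℝ → ℝ) (ν : Measure ℝ) (n : ℕ) : ℝ :=
  ∫ x, (⨆ t : ℝ, |K^[n] (indic t) x - ∫ y, indic t y ∂ν|) ∂ν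

/-- The dependence coefficient `β_k(n)`. -/
def betaCoef (K : (ℝ → ℝ) → ℝ → ℝ) (ν : Measure ℝ) (k n : ℕ) : ℝ :=
  max (beta1 K ν n)
    (⨆ j : Fin (k - 1), ⨆ ns : {m : Fin (j.1 + 1) → ℕ // ∀ i, 1 ≤ m i},
      ∫ x, (⨆ ts : Fin (j.1 + 2) → ℝ,
        |nestedK K (tList n ns.1 ts) x - ∫ y, nestedK K (tList n ns.1 ts) y ∂ν|) ∂ν)

/-- The operator associated with a Markov transition kernel: `(Kg)(x) = ∫ g(y) K(x,dy)`. -/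
def Kop (K : Kernel ℝ ℝ) (g : ℝ → ℝ) : ℝ → ℝ := fun x => ∫ y, g y ∂(K x)

/-- The class `Mon(M,p,μ)` of monotonic functions on an open interval, vanishing
elsewhere, with tail condition `μ(|g|>t) ≤ M^p t^{-p}` (for `p < ∞`),
resp. `μ(|g|>M) = 0` (for `p = ∞`). -/
def Mon (M : ℝ) (p : ℝ≥0∞) (μ : Measure ℝ) (g : ℝ → ℝ) : Prop :=
  (∃ I : Set ℝ, IsOpen I ∧ I.OrdConnected ∧ (MonotoneOn g I ∨ AntitoneOn g I) ∧
      ∀ x ∉ I, g x = 0) ∧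
  (if p = ∞ then μ {x | M < |g x|} = 0
   else ∀ t : ℝ, 0 < t →
      μ {x | t < |g x|} ≤ ENNReal.ofReal (M ^ p.toReal * t ^ (-p.toReal)))

/-- The class `C(M,p,μ)`: the closure in `L¹(μ)` of convex-type combinations
`∑ a_i g_i`, `∑ |a_i| ≤ 1`, `g_i ∈ Mon(M,p,μ)`. -/
def ClassC (M : ℝ) (p : ℝ≥0∞) (μ : Measure ℝ) (f : ℝ → ℝ) : Prop :=
  Integrable f μ ∧ ∀ ε : ℝ, 0 < ε → ∃ (n : ℕ) (a : Fin n → ℝ) (g : Fin n → ℝ → ℝ),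
    (∑ i, |a i|) ≤ 1 ∧ (∀ i, Mon M p μ (g i)) ∧
    ∫ x, |f x - ∑ i, a i * g i x| ∂μ < ε

/-- The class `Lip_c` of functions `g` with `|g(x) − g(y)| ≤ c(|x−y|)`. -/
def LipC (c : ℝ → ℝ) : Set (ℝ → ℝ) := {g | ∀ x y : ℝ, |g x - g y| ≤ c |x - y|}

/-- The distance `d_c(P,Q) = sup_{g ∈ Lip_c} |P(g) − Q(g)|`. -/
def dC (c : ℝ → ℝ) (P Q : Measure ℝ) : ℝ :=
  ⨆ g : LipC c, |(∫ x, (g : ℝ → ℝ) x ∂P) - ∫ x, (g : ℝ → ℝ) x ∂Q|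


namespace Intermittent


/-! ### The two branches of the intermittent map -/

/-- A strictly increasing extension to `ℝ` of the left branch of `Tmap γ`. -/
def leftBranch (γ y : ℝ) : ℝ := y + 2 ^ γ * max y 0 ^ (1 + γ)

lemma strictMono_leftBranch {γ : ℝ} (hγ : 0 < γ) : StrictMono (leftBranch γ) := by
  intro a b hab
  have h2 : (0 : ℝ) < 2 ^ γ := by positivity
  have : max a 0 ^ (1 + γ) ≤ max b 0 ^ (1 + γ) :=
    Real.rpow_le_rpow (le_max_right _ _) (max_le_max hab.le le_rfl) (by linarith)
  unfold leftBranch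
  nlinarith

lemma continuous_leftBranch {γ : ℝ} (hγ : 0 < γ) : Continuous (leftBranch γ) := by
  unfold leftBranch
  exact continuous_id.add (continuous_const.mul
    ((continuous_id.max continuous_const).rpow_const fun _ => Or.inr (by linarith)))

lemma le_leftBranch (γ y : ℝ) : y ≤ leftBranch γ y := by
  have : 0 ≤ (2 : ℝ) ^ γ * max y 0 ^ (1 + γ) := by positivity
  unfold leftBranch
  linarith

lemma leftBranch_of_nonpos {γ : ℝ} (hγ : 0 < γ) {y : ℝ} (hy : y ≤ 0) : leftBranch γ y = y := by
  simp [leftBranch, max_eq_right hy, Real.zero_rpow (by linarith : 1 + γ ≠ 0)]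

lemma leftBranch_of_nonneg {γ : ℝ} (hγ : 0 < γ) {y : ℝ} (hy : 0 ≤ y) :
    leftBranch γ y = y * (1 + 2 ^ γ * y ^ γ) := by
  rw [leftBranch, max_eq_left hy, Real.rpow_add' hy (by linarith), Real.rpow_one]
  ring

lemma leftBranch_half {γ : ℝ} (hγ : 0 < γ) : leftBranch γ (1 / 2) = 1 := by
  rw [leftBranch_of_nonneg hγ (by norm_num), ← Real.mul_rpow (by norm_num) (by norm_num)]
  norm_num

lemma exists_leftBranch_inverse {γ : ℝ} (hγ : 0 < γ) :
    ∃ V : ℝ → ℝ, Monotone V ∧ (∀ y, V (leftBranch γ y) = y) ∧ ∀ x, leftBranch γ (V x) = x := by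
  have hs : Function.Surjective (leftBranch γ) := by
    refine (continuous_leftBranch hγ).surjective ?_ ?_
    · exact tendsto_atTop_mono (le_leftBranch γ) tendsto_id
    · refine tendsto_id.congr' ?_
      filter_upwards [eventually_le_atBot 0] with y hy
      exact (leftBranch_of_nonpos hγ hy).symm
  let e := (strictMono_leftBranch hγ).orderIsoOfSurjective _ hs
  exact ⟨e.symm, e.symm.monotone, e.symm_apply_apply, e.apply_symm_apply⟩

lemma Tmap_of_lt {γ : ℝ} (hγ : 0 < γ) {x : ℝ} (h0 : 0 ≤ x) (hx : x < 1 / 2) :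
    Tmap γ x = leftBranch γ x := by
  rw [leftBranch_of_nonneg hγ h0, Tmap, if_pos hx]

lemma Tmap_of_ge {γ x : ℝ} (hx : 1 / 2 ≤ x) : Tmap γ x = 2 * x - 1 := by
  rw [Tmap, if_neg (not_lt.2 hx)]

lemma measurable_Tmap (γ : ℝ) : Measurable (Tmap γ) := by
  unfold Tmap
  exact Measurable.ite measurableSet_Iio (by fun_prop) (by fun_prop)

lemma Tmap_mem_Ico {γ : ℝ} (hγ : 0 < γ) {x : ℝ} (hx : x ∈ Ico (0 : ℝ) 1) :
    Tmap γ x ∈ Ico (0 : ℝ) 1 := by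
  rcases lt_or_ge x (1 / 2) with h | h
  · rw [Tmap_of_lt hγ hx.1 h]
    exact ⟨hx.1.trans (le_leftBranch _ _), leftBranch_half hγ ▸ strictMono_leftBranch hγ h⟩
  · rw [Tmap_of_ge h]
    exact ⟨by linarith, by linarith [hx.2]⟩

lemma iterate_Tmap_mem_Ico {γ : ℝ} (hγ : 0 < γ) {x : ℝ} (hx : x ∈ Ico (0 : ℝ) 1) (n : ℕ) :
    (Tmap γ)^[n] x ∈ Ico (0 : ℝ) 1 := by
  induction n with
  | zero => exact hx
  | succ n ih =>
    rw [Function.iterate_succ_apply']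
    exact Tmap_mem_Ico hγ ih

/-! ### The cone of densities preserved by both branches -/

/-- Lebesgue measure on the open unit interval. -/
def unitLeb : Measure ℝ := volume.restrict (Ioo 0 1)

instance : IsProbabilityMeasure unitLeb := ⟨by simp [unitLeb]⟩

/-- Densities `h` on `(0,1)` such that `h` is decreasing and `x ^ (1 + γ) * h x` is increasing. -/
def ConeDensity (γ : ℝ) (h : ℝ → ℝ≥0∞) : Prop :=
  Measurable h ∧ ∀ x y : ℝ, 0 < x → x ≤ y → y < 1 →
    h y ≤ h x ∧ ENNReal.ofReal (x ^ (1 + γ)) * h x ≤ ENNReal.ofReal (y ^ (1 + γ)) * h y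

/-- Measures on `(0,1)` whose density belongs to the cone. -/
def Cone (γ : ℝ) : Set (Measure ℝ) :=
  {Q | ∃ h, ConeDensity γ h ∧ Q = unitLeb.withDensity h}

/-- Measures of the cone whose density has oscillation ratio at most `4`. -/
def FlatCone (γ : ℝ) : Set (Measure ℝ) :=
  {Q | ∃ h, ConeDensity γ h ∧ (∀ x ∈ Ioo (0 : ℝ) 1, ∀ y ∈ Ioo (0 : ℝ) 1, h x ≤ 4 * h y) ∧
    Q = unitLeb.withDensity h}

lemma FlatCone_subset_Cone (γ : ℝ) : FlatCone γ ⊆ Cone γ := fun _ ⟨h, h1, _, h3⟩ => ⟨h, h1, h3⟩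

lemma ConeDensity_one {γ : ℝ} (hγ : 0 < γ) : ConeDensity γ 1 := by
  refine ⟨measurable_one, fun x y hx hxy _ => ⟨le_rfl, ?_⟩⟩
  simp only [Pi.one_apply, mul_one]
  exact ENNReal.ofReal_le_ofReal (Real.rpow_le_rpow hx.le hxy (by linarith))

lemma unitLeb_mem_FlatCone {γ : ℝ} (hγ : 0 < γ) : unitLeb ∈ FlatCone γ := by
  refine ⟨1, ConeDensity_one hγ, fun x _ y _ => ?_, by simp⟩
  simp only [Pi.one_apply, mul_one]
  norm_num

lemma ConeDensity.const_mul {γ : ℝ} {h : ℝ → ℝ≥0∞} (hh : ConeDensity γ h) (c : ℝ≥0∞) :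
    ConeDensity γ (fun x => c * h x) := by
  refine ⟨hh.1.const_mul c, fun x y h0 hxy h1 => ⟨?_, ?_⟩⟩
  · exact mul_le_mul_right (hh.2 x y h0 hxy h1).1 c
  · rw [mul_left_comm, mul_left_comm _ c]
    exact mul_le_mul_right (hh.2 x y h0 hxy h1).2 c

lemma ConeDensity.tsum {γ : ℝ} {h : ℕ → ℝ → ℝ≥0∞} (hh : ∀ i, ConeDensity γ (h i)) :
    ConeDensity γ (fun x => ∑' i, h i x) := by
  refine ⟨Measurable.tsum fun i => (hh i).1, fun x y h0 hxy h1 => ⟨?_, ?_⟩⟩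
  · exact ENNReal.tsum_le_tsum fun i => ((hh i).2 x y h0 hxy h1).1
  · rw [← ENNReal.tsum_mul_left, ← ENNReal.tsum_mul_left]
    exact ENNReal.tsum_le_tsum fun i => ((hh i).2 x y h0 hxy h1).2

lemma Cone.smul_mem {γ : ℝ} {Q : Measure ℝ} (hQ : Q ∈ Cone γ) (c : ℝ≥0∞) : c • Q ∈ Cone γ := by
  obtain ⟨h, hh, rfl⟩ := hQ
  exact ⟨_, hh.const_mul c, (withDensity_smul c hh.1).symm⟩

lemma FlatCone.smul_mem {γ : ℝ} {Q : Measure ℝ} (hQ : Q ∈ FlatCone γ) (c : ℝ≥0∞) :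
    c • Q ∈ FlatCone γ := by
  obtain ⟨h, hh, h4, rfl⟩ := hQ
  refine ⟨_, hh.const_mul c, fun x hx y hy => ?_, (withDensity_smul c hh.1).symm⟩
  rw [mul_left_comm]
  exact mul_le_mul_right (h4 x hx y hy) c

lemma FlatCone.sum_mem {γ : ℝ} {Q : ℕ → Measure ℝ} (hQ : ∀ i, Q i ∈ FlatCone γ) :
    Measure.sum Q ∈ FlatCone γ := by
  choose h hh h4 he using hQ
  refine ⟨_, ConeDensity.tsum hh, fun x hx y hy => ?_, ?_⟩
  · rw [← ENNReal.tsum_mul_left]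
    exact ENNReal.tsum_le_tsum fun i => h4 i x hx y hy
  · ext E hE
    simp only [Measure.sum_apply _ hE, he, withDensity_apply _ hE]
    rw [lintegral_tsum fun i => (hh i).1.aemeasurable]

lemma FlatCone.apply_le {γ : ℝ} {Q : Measure ℝ} (hQ : Q ∈ FlatCone γ) {E : Set ℝ}
    (hE : MeasurableSet E) : Q E ≤ 4 * Q univ * unitLeb E := by
  obtain ⟨h, hh, h4, rfl⟩ := hQ
  have key : ∀ x ∈ Ioo (0 : ℝ) 1, h x ≤ 4 * (unitLeb.withDensity h) univ := by
    intro x hx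
    calc h x = ∫⁻ _, h x ∂unitLeb := by simp
      _ ≤ ∫⁻ y, 4 * h y ∂unitLeb := by
        refine lintegral_mono_ae ?_
        filter_upwards [ae_restrict_mem measurableSet_Ioo] with y hy using h4 x hx y hy
      _ = _ := by rw [lintegral_const_mul _ hh.1, withDensity_apply _ .univ, Measure.restrict_univ]
  rw [withDensity_apply _ hE]
  calc ∫⁻ x in E, h x ∂unitLeb
      ≤ ∫⁻ _ in E, 4 * (unitLeb.withDensity h) univ ∂unitLeb := by
        refine lintegral_mono_ae (ae_restrict_of_ae ?_)
        filter_upwards [ae_restrict_mem measurableSet_Ioo] with y hy using key y hy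
    _ = _ := by simp

lemma FlatCone.le_apply {γ : ℝ} {Q : Measure ℝ} (hQ : Q ∈ FlatCone γ) {E : Set ℝ}
    (hE : MeasurableSet E) : Q univ * unitLeb E ≤ 4 * Q E := by
  obtain ⟨h, hh, h4, rfl⟩ := hQ
  have key : ∀ x ∈ Ioo (0 : ℝ) 1, (unitLeb.withDensity h) univ ≤ 4 * h x := by
    intro x hx
    rw [withDensity_apply _ .univ, Measure.restrict_univ]
    calc ∫⁻ y, h y ∂unitLeb
        ≤ ∫⁻ _, 4 * h x ∂unitLeb := by
          refine lintegral_mono_ae ?_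
          filter_upwards [ae_restrict_mem measurableSet_Ioo] with y hy using h4 y hy x hx
      _ = _ := by simp
  calc _ = ∫⁻ _ in E, (unitLeb.withDensity h) univ ∂unitLeb := by simp
    _ ≤ ∫⁻ x in E, 4 * h x ∂unitLeb := by
        refine lintegral_mono_ae (ae_restrict_of_ae ?_)
        filter_upwards [ae_restrict_mem measurableSet_Ioo] with y hy using key y hy
    _ = _ := by rw [lintegral_const_mul _ hh.1, withDensity_apply _ hE]

/-- Push-forward by `Tmap γ` of the part of `Q` on the left half. -/
def pushL (γ : ℝ) (Q : Measure ℝ) : Measure ℝ := (Q.restrict (Iio (1 / 2))).map (Tmap γ)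

/-- Push-forward by `Tmap γ` of the part of `Q` on the right half. -/
def pushR (γ : ℝ) (Q : Measure ℝ) : Measure ℝ := (Q.restrict (Ici (1 / 2))).map (Tmap γ)

lemma map_restrict_withDensity_eq {T φ φ' V : ℝ → ℝ} {s D : Set ℝ} {h : ℝ → ℝ≥0∞}
    (hs : MeasurableSet s) (hT : Measurable T) (hD : MeasurableSet D)
    (hDs : D ∩ Ioo 0 1 = s) (hTφ : ∀ y ∈ s, T y = φ y)
    (hder : ∀ y ∈ s, HasDerivWithinAt φ (φ' y) s y) (hpos : ∀ y ∈ s, 0 < φ' y)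
    (himg : φ '' s =ᵐ[volume] Ioo (0 : ℝ) 1) (hV : ∀ y ∈ s, V (φ y) = y) :
    ((unitLeb.withDensity h).restrict D).map T =
      unitLeb.withDensity (fun x => h (V x) / ENNReal.ofReal (φ' (V x))) := by
  have hinj : InjOn φ s := fun a ha b hb hab => by rw [← hV a ha, ← hV b hb, hab]
  ext E hE
  rw [Measure.map_apply hT hE, Measure.restrict_apply (hT hE),
    withDensity_apply _ ((hT hE).inter hD), withDensity_apply _ hE, unitLeb,
    Measure.restrict_restrict ((hT hE).inter hD), inter_assoc, hDs, ← lintegral_indicator hE,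
    ← Measure.restrict_congr_set himg,
    lintegral_image_eq_lintegral_abs_deriv_mul hs hder hinj, ← Measure.restrict_restrict (hT hE),
    ← lintegral_indicator (hT hE)]
  refine setLIntegral_congr_fun hs fun y hy => ?_
  have hmem : y ∈ T ⁻¹' E ↔ φ y ∈ E := by rw [mem_preimage, hTφ y hy]
  by_cases hyE : φ y ∈ E
  · rw [indicator_of_mem (hmem.2 hyE), indicator_of_mem hyE, hV y hy, abs_of_pos (hpos y hy),
      ENNReal.mul_div_cancel]
    · exact (ENNReal.ofReal_pos.2 (hpos y hy)).ne'
    · exact ENNReal.ofReal_ne_top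
  · rw [indicator_of_notMem (fun hy' => hyE (hmem.1 hy')), indicator_of_notMem hyE, mul_zero]

lemma rpow_div_mono {γ s t : ℝ} (hγ : 0 < γ) (hs : 0 ≤ s) (hst : s ≤ t) :
    (1 + s) ^ (1 + γ) / (1 + (1 + γ) * s) ≤ (1 + t) ^ (1 + γ) / (1 + (1 + γ) * t) := by
  have h1 : 0 < 1 + s := by linarith
  have hB := one_add_mul_self_le_rpow_one_add (s := (t - s) / (1 + s)) (p := 1 + γ)
    (by have : 0 ≤ (t - s) / (1 + s) := div_nonneg (by linarith) h1.le
        linarith) (by linarith)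
  have he : 1 + (t - s) / (1 + s) = (1 + t) / (1 + s) := by field_simp; ring
  rw [he, Real.div_rpow (by linarith) h1.le, le_div_iff₀ (Real.rpow_pos_of_pos h1 _)] at hB
  have hs' : 0 < 1 + (1 + γ) * s := by nlinarith
  have ht' : 0 < 1 + (1 + γ) * t := by nlinarith
  rw [div_le_div_iff₀ hs' ht']
  have hle : (1 + (1 + γ) * t) / (1 + (1 + γ) * s) ≤ 1 + (1 + γ) * ((t - s) / (1 + s)) := by
    rw [div_le_iff₀ hs']
    have h3 : 0 ≤ (1 + γ) * ((t - s) / (1 + s)) * (γ * s) := by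
      have : 0 ≤ (t - s) / (1 + s) := div_nonneg (by linarith) h1.le
      positivity
    have h4 : (t - s) / (1 + s) * (1 + s) = t - s := by field_simp
    nlinarith
  have hP : 0 < (1 + s) ^ (1 + γ) := Real.rpow_pos_of_pos h1 _
  calc (1 + s) ^ (1 + γ) * (1 + (1 + γ) * t)
      = (1 + (1 + γ) * t) / (1 + (1 + γ) * s) * (1 + s) ^ (1 + γ) * (1 + (1 + γ) * s) := by
        field_simp
    _ ≤ (1 + (1 + γ) * ((t - s) / (1 + s))) * (1 + s) ^ (1 + γ) * (1 + (1 + γ) * s) := by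
        gcongr
    _ ≤ _ := by gcongr

lemma hasDerivAt_leftBranch (γ : ℝ) {y : ℝ} (hy : 0 < y) :
    HasDerivAt (leftBranch γ) (1 + (1 + γ) * (2 ^ γ * y ^ γ)) y := by
  have h1 : HasDerivAt (fun y : ℝ => y + 2 ^ γ * y ^ (1 + γ))
      (1 + 2 ^ γ * ((1 + γ) * y ^ (1 + γ - 1))) y :=
    (hasDerivAt_id y).add ((Real.hasDerivAt_rpow_const (Or.inl hy.ne')).const_mul _)
  have h2 : HasDerivAt (leftBranch γ) (1 + 2 ^ γ * ((1 + γ) * y ^ (1 + γ - 1))) y := by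
    refine h1.congr_of_eventuallyEq ?_
    filter_upwards [lt_mem_nhds hy] with z hz
    rw [leftBranch, max_eq_left hz.le]
  convert h2 using 1
  rw [add_sub_cancel_left]
  ring

lemma pushL_mem_Cone {γ : ℝ} (hγ : 0 < γ) {Q : Measure ℝ} (hQ : Q ∈ Cone γ) :
    pushL γ Q ∈ Cone γ := by
  obtain ⟨h, hh, rfl⟩ := hQ
  obtain ⟨V, hVm, hVl, hVr⟩ := exists_leftBranch_inverse hγ
  have hsm := strictMono_leftBranch hγ
  have hVmem : ∀ x, 0 < x → x < 1 → 0 < V x ∧ V x < 1 / 2 := by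
    intro x h0 h1
    constructor
    · rw [← hsm.lt_iff_lt, hVr, leftBranch_of_nonpos hγ le_rfl]; exact h0
    · rw [← hsm.lt_iff_lt, hVr, leftBranch_half hγ]; exact h1
  refine ⟨_, ?_, map_restrict_withDensity_eq (V := V) (φ := leftBranch γ)
    (φ' := fun y => 1 + (1 + γ) * (2 ^ γ * y ^ γ)) (s := Ioo 0 (1 / 2)) measurableSet_Ioo
    (measurable_Tmap γ) measurableSet_Iio ?_ ?_ ?_ ?_ ?_ ?_⟩
  · refine ⟨(hh.1.comp hVm.measurable).div (Measurable.ennreal_ofReal ?_), ?_⟩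
    · have := hVm.measurable
      fun_prop
    intro x y hx hxy hy
    obtain ⟨hx0, hx1⟩ := hVmem x hx (hxy.trans_lt hy)
    obtain ⟨hy0, hy1⟩ := hVmem y (hx.trans_le hxy) hy
    have hVxy := hVm hxy
    obtain ⟨hc1, hc2⟩ := hh.2 (V x) (V y) hx0 hVxy (by linarith)
    constructor
    · refine ENNReal.div_le_div hc1 (ENNReal.ofReal_le_ofReal ?_)
      have := Real.rpow_le_rpow hx0.le hVxy hγ.le
      gcongr
    · have key : ∀ z, 0 < V z → ENNReal.ofReal (z ^ (1 + γ)) *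
          (h (V z) / ENNReal.ofReal (1 + (1 + γ) * (2 ^ γ * V z ^ γ))) =
          ENNReal.ofReal ((1 + 2 ^ γ * V z ^ γ) ^ (1 + γ) / (1 + (1 + γ) * (2 ^ γ * V z ^ γ))) *
            (ENNReal.ofReal (V z ^ (1 + γ)) * h (V z)) := by
        intro z hz
        have hpos : 0 < 1 + (1 + γ) * (2 ^ γ * V z ^ γ) := by positivity
        have hz' : z ^ (1 + γ) = (1 + 2 ^ γ * V z ^ γ) ^ (1 + γ) * V z ^ (1 + γ) := by
          rw [← Real.mul_rpow (by positivity) hz.le, mul_comm, ← leftBranch_of_nonneg hγ hz.le, hVr]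
        rw [hz', ENNReal.ofReal_mul (by positivity), ENNReal.ofReal_div_of_pos hpos]
        simp only [div_eq_mul_inv]
        ring
      rw [key x hx0, key y hy0]
      refine mul_le_mul' (ENNReal.ofReal_le_ofReal (rpow_div_mono hγ (by positivity) ?_)) hc2
      have := Real.rpow_le_rpow hx0.le hVxy hγ.le
      gcongr
  · ext z
    simp only [mem_inter_iff, mem_Iio, mem_Ioo]
    constructor
    · rintro ⟨h1, h2, h3⟩; exact ⟨h2, h1⟩
    · rintro ⟨h1, h2⟩; exact ⟨h2, h1, by linarith⟩
  · exact fun y hy => Tmap_of_lt hγ hy.1.le hy.2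
  · exact fun y hy => (hasDerivAt_leftBranch γ hy.1).hasDerivWithinAt
  · intro y hy
    have := hy.1
    positivity
  · refine Eq.eventuallyEq ?_
    ext z
    constructor
    · rintro ⟨y, hy, rfl⟩
      exact ⟨hy.1.trans_le (le_leftBranch _ _), leftBranch_half hγ ▸ hsm hy.2⟩
    · exact fun hz => ⟨V z, hVmem z hz.1 hz.2, hVr z⟩
  · exact fun y _ => hVl y

lemma pushR_mem_FlatCone {γ : ℝ} (hγ : γ ∈ Ioo (0 : ℝ) 1) {Q : Measure ℝ} (hQ : Q ∈ Cone γ) :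
    pushR γ Q ∈ FlatCone γ := by
  obtain ⟨h, hh, rfl⟩ := hQ
  have hγ0 := hγ.1
  have hγ1 := hγ.2
  have hflat : ∀ x ∈ Ioo (0 : ℝ) 1, ∀ y ∈ Ioo (0 : ℝ) 1,
      h ((x + 1) / 2) ≤ 4 * h ((y + 1) / 2) := by
    intro x hx y hy
    rcases le_total y x with hyx | hxy
    · refine ((hh.2 ((y + 1) / 2) ((x + 1) / 2) (by linarith [hy.1]) (by linarith)
        (by linarith [hx.2])).1).trans ?_
      exact le_mul_of_one_le_left (zero_le) (by norm_num)
    · have h2 := (hh.2 ((x + 1) / 2) ((y + 1) / 2) (by linarith [hx.1]) (by linarith)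
        (by linarith [hy.2])).2
      have hxp : (1 / 4 : ℝ) ≤ ((x + 1) / 2) ^ (1 + γ) := by
        calc (1 / 4 : ℝ) = (1 / 2) ^ (2 : ℝ) := by norm_num
          _ ≤ (1 / 2) ^ (1 + γ) :=
            Real.rpow_le_rpow_of_exponent_ge (by norm_num) (by norm_num) (by linarith)
          _ ≤ _ := Real.rpow_le_rpow (by norm_num) (by linarith [hx.1]) (by linarith)
      have hyp : ((y + 1) / 2) ^ (1 + γ) ≤ 1 :=
        Real.rpow_le_one (by linarith [hy.1]) (by linarith [hy.2]) (by linarith)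
      calc h ((x + 1) / 2) = 4 * (ENNReal.ofReal (1 / 4) * h ((x + 1) / 2)) := by
            rw [← mul_assoc, ← ENNReal.ofReal_ofNat 4, ← ENNReal.ofReal_mul (by norm_num)]
            norm_num
        _ ≤ 4 * (ENNReal.ofReal (((x + 1) / 2) ^ (1 + γ)) * h ((x + 1) / 2)) := by gcongr
        _ ≤ 4 * (ENNReal.ofReal (((y + 1) / 2) ^ (1 + γ)) * h ((y + 1) / 2)) := by gcongr
        _ ≤ 4 * (ENNReal.ofReal 1 * h ((y + 1) / 2)) := by gcongr
        _ = _ := by simp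
  refine ⟨_, ?_, ?_, map_restrict_withDensity_eq (V := fun x => (x + 1) / 2)
    (φ := fun x => 2 * x - 1) (φ' := fun _ => 2) (s := Ico (1 / 2) 1) measurableSet_Ico
    (measurable_Tmap γ) measurableSet_Ici ?_ ?_ ?_ ?_ ?_ ?_⟩
  · refine ⟨(hh.1.comp (by fun_prop)).div measurable_const, fun x y hx hxy hy => ⟨?_, ?_⟩⟩
    · exact ENNReal.div_le_div_right (hh.2 ((x + 1) / 2) ((y + 1) / 2) (by linarith)
        (by linarith) (by linarith)).1 _
    · have key : ∀ z : ℝ, 0 < z → ENNReal.ofReal (z ^ (1 + γ)) * (h ((z + 1) / 2) /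
          ENNReal.ofReal 2) = ENNReal.ofReal ((z / ((z + 1) / 2)) ^ (1 + γ)) *
          (ENNReal.ofReal (((z + 1) / 2) ^ (1 + γ)) * h ((z + 1) / 2)) / ENNReal.ofReal 2 := by
        intro z hz
        rw [← mul_assoc, ← ENNReal.ofReal_mul (by positivity), ← Real.mul_rpow (by positivity)
          (by positivity), div_mul_cancel₀ _ (by positivity), mul_div_assoc]
      rw [key x hx, key y (hx.trans_le hxy)]
      refine ENNReal.div_le_div_right (mul_le_mul' (ENNReal.ofReal_le_ofReal
        (Real.rpow_le_rpow (by positivity) ?_ (by linarith))) (hh.2 ((x + 1) / 2) ((y + 1) / 2)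
          (by linarith) (by linarith) (by linarith)).2) _
      rw [div_le_div_iff₀ (by linarith) (by linarith)]
      nlinarith
  · intro x hx y hy
    rw [← mul_div_assoc]
    exact ENNReal.div_le_div_right (hflat x hx y hy) _
  · ext z
    simp only [mem_inter_iff, mem_Ici, mem_Ioo, mem_Ico]
    constructor
    · rintro ⟨h1, h2, h3⟩; exact ⟨h1, h3⟩
    · rintro ⟨h1, h2⟩; exact ⟨h1, by linarith, h2⟩
  · exact fun y hy => Tmap_of_ge hy.1
  · intro y _
    simpa using (((hasDerivAt_id y).const_mul (2 : ℝ)).sub_const 1).hasDerivWithinAt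
  · intro y _
    norm_num
  · have : (fun x : ℝ => 2 * x - 1) '' Ico (1 / 2) 1 = Ico 0 1 := by
      ext z
      constructor
      · rintro ⟨y, hy, rfl⟩
        exact ⟨by linarith [hy.1], by linarith [hy.2]⟩
      · exact fun hz => ⟨(z + 1) / 2, ⟨by linarith [hz.1], by linarith [hz.2]⟩, by ring⟩
    rw [this]
    exact Ioo_ae_eq_Ico.symm
  · intro y _
    ring

lemma lintegral_pushL (γ : ℝ) (Q : Measure ℝ) {H : ℝ → ℝ≥0∞} (hH : Measurable H) :
    ∫⁻ x, H x ∂(pushL γ Q) = ∫⁻ y in Iio (1 / 2), H (Tmap γ y) ∂Q :=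
  lintegral_map hH (measurable_Tmap γ)

lemma lintegral_pushR (γ : ℝ) (Q : Measure ℝ) {H : ℝ → ℝ≥0∞} (hH : Measurable H) :
    ∫⁻ x, H x ∂(pushR γ Q) = ∫⁻ y in Ici (1 / 2), H (Tmap γ y) ∂Q :=
  lintegral_map hH (measurable_Tmap γ)

/-! ### Expansion estimates near the neutral fixed point -/

lemma two_rpow_mul_rpow_le_one {γ u : ℝ} (hγ : 0 < γ) (hu : 0 ≤ u) (hu' : u ≤ 1 / 2) :
    2 ^ γ * u ^ γ ≤ 1 := by
  rw [← Real.mul_rpow (by norm_num) hu]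
  exact Real.rpow_le_one (by positivity) (by linarith) hγ.le

lemma leftBranch_rpow_neg_add_le {γ u : ℝ} (hγ : γ ∈ Ioo (0 : ℝ) 1) (hu : 0 < u)
    (hu' : u ≤ 1 / 2) : leftBranch γ u ^ (-γ) + γ / 2 ≤ u ^ (-γ) := by
  obtain ⟨hγ0, hγ1⟩ := hγ
  have hs1 := two_rpow_mul_rpow_le_one hγ0 hu.le hu'
  rw [leftBranch_of_nonneg hγ0 hu.le]
  have hs0 : 0 < (2 : ℝ) ^ γ * u ^ γ := by positivity
  have h2 : (1 : ℝ) ≤ 2 ^ γ := Real.one_le_rpow (by norm_num) hγ0.le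
  have hus : u ^ (-γ) * (2 ^ γ * u ^ γ) = 2 ^ γ := by
    rw [mul_left_comm, ← Real.rpow_add hu]; simp
  have hP : 0 < u ^ (-γ) := by positivity
  set s := (2 : ℝ) ^ γ * u ^ γ
  rw [Real.mul_rpow hu.le (by linarith)]
  have hB : (1 + s) ^ (-γ) ≤ 1 - γ * (s / (1 + s)) := by
    have h := rpow_one_add_le_one_add_mul_self (s := -(s / (1 + s))) (p := γ)
      (by rw [neg_le_neg_iff, div_le_one (by linarith)]; linarith) hγ0.le hγ1.le
    have he : 1 + -(s / (1 + s)) = (1 + s)⁻¹ := by field_simp; ring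
    rw [he, Real.inv_rpow (by linarith), ← Real.rpow_neg (by linarith)] at h
    linarith
  have h3 : 1 / 2 ≤ u ^ (-γ) * (s / (1 + s)) := by
    rw [← mul_div_assoc, hus, div_le_div_iff₀ (by norm_num) (by linarith)]
    linarith
  have h4 := mul_le_mul_of_nonneg_left hB hP.le
  nlinarith

lemma mul_le_rpow_neg_of_leftBranch_le {γ : ℝ} (hγ : γ ∈ Ioo (0 : ℝ) 1) (k : ℕ) :
    ∀ u : ℕ → ℝ, 0 < u 0 → (∀ i < k, u i ≤ 1 / 2 ∧ leftBranch γ (u i) ≤ u (i + 1)) →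
      k * (γ / 2) ≤ u 0 ^ (-γ) := by
  induction k with
  | zero =>
    intro u h0 _
    simpa using Real.rpow_nonneg h0.le _
  | succ k ih =>
    intro u h0 hu
    obtain ⟨h1, h2⟩ := hu 0 k.succ_pos
    have h3 : 0 < leftBranch γ (u 0) := h0.trans_le (le_leftBranch _ _)
    have h4 := ih (fun i => u (i + 1)) (h3.trans_le h2) fun i hi => hu (i + 1) (by omega)
    have h5 := leftBranch_rpow_neg_add_le hγ h0 h1
    have h6 : u (0 + 1) ^ (-γ) ≤ leftBranch γ (u 0) ^ (-γ) :=
      Real.rpow_le_rpow_of_nonpos h3 h2 (by linarith [hγ.1])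
    push_cast
    linarith

lemma le_rpow_of_mul_le_rpow_neg {γ u c : ℝ} (hγ : 0 < γ) (hu : 0 < u) (hc : 0 < c)
    (h : c ≤ u ^ (-γ)) : u ≤ c ^ (-(1 / γ)) := by
  have h1 := Real.rpow_le_rpow_of_nonpos hc h (by
    have : 0 < 1 / γ := by positivity
    linarith : -(1 / γ) ≤ 0)
  rwa [← Real.rpow_mul hu.le, neg_mul_neg, mul_one_div_cancel hγ.ne', Real.rpow_one] at h1

/-- Points whose first `k` iterates stay in the left half. -/
def stayLeft (γ : ℝ) (k : ℕ) : Set ℝ := {y | ∀ i < k, (Tmap γ)^[i] y < 1 / 2}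

lemma measurableSet_stayLeft (γ : ℝ) (k : ℕ) : MeasurableSet (stayLeft γ k) := by
  simp only [stayLeft, ofPred_forall]
  exact MeasurableSet.iInter fun i => MeasurableSet.iInter fun _ =>
    measurableSet_lt ((measurable_Tmap γ).iterate i) measurable_const

lemma stayLeft_succ (γ : ℝ) (k : ℕ) :
    stayLeft γ (k + 1) = Iio (1 / 2) ∩ Tmap γ ⁻¹' stayLeft γ k := by
  ext y
  simp only [stayLeft, mem_ofPred_eq, mem_inter_iff, mem_Iio, mem_preimage]
  refine ⟨fun h => ⟨h 0 k.succ_pos, fun i hi => by simpa using h (i + 1) (by omega)⟩,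
    fun ⟨h1, h2⟩ i hi => ?_⟩
  cases i with
  | zero => exact h1
  | succ i => simpa using h2 i (by omega)

lemma stayLeft_anti (γ : ℝ) : Antitone (stayLeft γ) :=
  fun _ _ hkl _ hy i hi => hy i (hi.trans_le hkl)

lemma le_of_mem_stayLeft {γ : ℝ} (hγ : γ ∈ Ioo (0 : ℝ) 1) {k : ℕ} (hk : 0 < k) {y : ℝ}
    (hy : y ∈ Ioo (0 : ℝ) 1) (hyk : y ∈ stayLeft γ k) : y ≤ (k * (γ / 2)) ^ (-(1 / γ)) := by
  have hγ0 := hγ.1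
  refine le_rpow_of_mul_le_rpow_neg hγ0 hy.1 (by positivity)
    (mul_le_rpow_neg_of_leftBranch_le hγ k (fun i => (Tmap γ)^[i] y) hy.1 fun i hi =>
      ⟨(hyk i hi).le, ?_⟩)
  rw [Function.iterate_succ_apply', Tmap_of_lt hγ0
    (iterate_Tmap_mem_Ico hγ0 ⟨hy.1.le, hy.2⟩ i).1 (hyk i hi)]

lemma unitLeb_stayLeft_le {γ : ℝ} (hγ : γ ∈ Ioo (0 : ℝ) 1) {k : ℕ} (hk : 0 < k) :
    unitLeb (stayLeft γ k) ≤ ENNReal.ofReal ((k * (γ / 2)) ^ (-(1 / γ))) := by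
  rw [unitLeb, Measure.restrict_apply (measurableSet_stayLeft γ k)]
  calc _ ≤ volume (Ioc 0 ((k * (γ / 2)) ^ (-(1 / γ)))) :=
        measure_mono fun y hy => ⟨hy.2.1, le_of_mem_stayLeft hγ hk hy.2 hy.1⟩
    _ = _ := by simp

lemma leftBranch_sub_le {γ a b : ℝ} (hγ : 0 < γ) (ha : 0 ≤ a) (hab : a ≤ b) :
    leftBranch γ (b - a) ≤ leftBranch γ b - leftBranch γ a := by
  have h := Real.add_rpow_le_rpow_add (p := 1 + γ) (sub_nonneg.2 hab) ha (by linarith)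
  rw [sub_add_cancel] at h
  simp only [leftBranch, max_eq_left ha, max_eq_left (ha.trans hab),
    max_eq_left (sub_nonneg.2 hab)]
  have h2 : (0 : ℝ) < 2 ^ γ := by positivity
  nlinarith

/-- The half of the interval containing the point: `0` on the left, `1` on the right. -/
def half (y : ℝ) : ℕ := if y < 1 / 2 then 0 else 1

lemma half_eq_iff {y y' : ℝ} : half y = half y' ↔ (y < 1 / 2 ↔ y' < 1 / 2) := by
  by_cases h : y < 1 / 2 <;> by_cases h' : y' < 1 / 2 <;> simp only [half, h, h'] <;> simp

lemma expansion_of_half_eq {γ : ℝ} (hγ : 0 < γ) {y y' : ℝ} (hy : y ∈ Ico (0 : ℝ) 1)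
    (hy' : y' ∈ Ico (0 : ℝ) 1) (h : half y = half y') :
    |y - y'| ≤ 1 / 2 ∧ leftBranch γ |y - y'| ≤ |Tmap γ y - Tmap γ y'| := by
  wlog hle : y' ≤ y generalizing y y'
  · rw [abs_sub_comm y, abs_sub_comm (Tmap γ y)]
    exact this hy' hy h.symm (le_of_not_ge hle)
  rw [half_eq_iff] at h
  rw [abs_of_nonneg (sub_nonneg.2 hle)]
  rcases lt_or_ge y (1 / 2) with hl | hr
  · refine ⟨by linarith [hy'.1], ?_⟩
    rw [Tmap_of_lt hγ hy.1 hl, Tmap_of_lt hγ hy'.1 (h.1 hl)]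
    exact (leftBranch_sub_le hγ hy'.1 hle).trans (le_abs_self _)
  · have hr' : 1 / 2 ≤ y' := by
      by_contra! hc
      exact (h.2 hc).not_ge hr
    have hd : y - y' ≤ 1 / 2 := by linarith [hy.2]
    refine ⟨hd, ?_⟩
    rw [Tmap_of_ge hr, Tmap_of_ge hr', leftBranch_of_nonneg hγ (sub_nonneg.2 hle)]
    refine le_trans ?_ (le_abs_self _)
    have := two_rpow_mul_rpow_le_one hγ (sub_nonneg.2 hle) hd
    nlinarith

/-- The list of the first `n` symbols of `y`, for the symbol function `σ` along orbits of `S`. -/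
def code (S : ℝ → ℝ) (σ : ℝ → ℕ) : ℕ → ℝ → List ℕ
  | 0, _ => []
  | n + 1, y => σ y :: code S σ n (S y)

lemma code_eq_iff {S : ℝ → ℝ} {σ : ℝ → ℕ} {n : ℕ} {y y' : ℝ} :
    code S σ n y = code S σ n y' ↔ ∀ i < n, σ (S^[i] y) = σ (S^[i] y') := by
  induction n generalizing y y' with
  | zero => simp [code]
  | succ n ih =>
    simp only [code, List.cons.injEq, ih]
    refine ⟨fun ⟨h1, h2⟩ i hi => ?_, fun h => ⟨h 0 n.succ_pos, fun i hi => h (i + 1) (by omega)⟩⟩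
    cases i with
    | zero => exact h1
    | succ i => exact h2 i (by omega)

lemma dist_le_of_code_eq {γ : ℝ} (hγ : γ ∈ Ioo (0 : ℝ) 1) {m : ℕ} (hm : 0 < m) {y y' : ℝ}
    (hy : y ∈ Ico (0 : ℝ) 1) (hy' : y' ∈ Ico (0 : ℝ) 1)
    (h : code (Tmap γ) half m y = code (Tmap γ) half m y') :
    |y - y'| ≤ (m * (γ / 2)) ^ (-(1 / γ)) := by
  have hγ0 := hγ.1
  rw [code_eq_iff] at h
  rcases eq_or_ne y y' with rfl | hne
  · simp only [sub_self, abs_zero]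
    positivity
  refine le_rpow_of_mul_le_rpow_neg hγ0 (abs_pos.2 (sub_ne_zero.2 hne)) (by positivity)
    (mul_le_rpow_neg_of_leftBranch_le hγ m (fun i => |(Tmap γ)^[i] y - (Tmap γ)^[i] y'|)
      (abs_pos.2 (sub_ne_zero.2 hne)) fun i hi => ?_)
  simp only [Function.iterate_succ_apply']
  exact expansion_of_half_eq hγ0 (iterate_Tmap_mem_Ico hγ0 hy i) (iterate_Tmap_mem_Ico hγ0 hy' i)
    (h i hi)

lemma tendsto_expansion_bound {γ : ℝ} (hγ : 0 < γ) :
    Tendsto (fun m : ℕ => ((m : ℝ) * (γ / 2)) ^ (-(1 / γ))) atTop (𝓝 0) :=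
  (tendsto_rpow_neg_atTop (by positivity)).comp
    (tendsto_natCast_atTop_atTop.atTop_mul_const (by positivity))

lemma tendsto_unitLeb_stayLeft {γ : ℝ} (hγ : γ ∈ Ioo (0 : ℝ) 1) :
    Tendsto (fun k => unitLeb (stayLeft γ k)) atTop (𝓝 0) := by
  have h := ENNReal.tendsto_ofReal (tendsto_expansion_bound hγ.1)
  rw [ENNReal.ofReal_zero] at h
  refine tendsto_of_tendsto_of_tendsto_of_le_of_le' tendsto_const_nhds h
    (Eventually.of_forall fun _ => zero_le) ?_
  filter_upwards [eventually_gt_atTop 0] with k hk using unitLeb_stayLeft_le hγ hk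

/-! ### Conditioning on symbols -/

lemma measurableSet_code_preimage {S : ℝ → ℝ} {σ : ℝ → ℕ} (hS : Measurable S) (hσ : Measurable σ)
    (n : ℕ) : ∀ s : Set (List ℕ), MeasurableSet (code S σ n ⁻¹' s) := by
  induction n with
  | zero => exact fun s => MeasurableSet.const ([] ∈ s)
  | succ n ih =>
    intro s
    have : code S σ (n + 1) ⁻¹' s =
        ⋃ k, σ ⁻¹' {k} ∩ S ⁻¹' (code S σ n ⁻¹' {l | k :: l ∈ s}) := by
      ext y
      simp [code]
    rw [this]
    exact MeasurableSet.iUnion fun k => (hσ (measurableSet_singleton k)).inter (hS (ih _))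

lemma measurable_comp_code {α : Type*} [MeasurableSpace α] {S : ℝ → ℝ} {σ : ℝ → ℕ}
    (hS : Measurable S) (hσ : Measurable σ) (n : ℕ) (g : List ℕ → α) :
    Measurable fun y => g (code S σ n y) :=
  fun s _ => measurableSet_code_preimage hS hσ n (g ⁻¹' s)

lemma lintegral_eq_tsum_fiber {σ : ℝ → ℕ} (hσ : Measurable σ) (Q : Measure ℝ) (F : ℝ → ℝ≥0∞) :
    ∫⁻ y, F y ∂Q = ∑' k, ∫⁻ y in σ ⁻¹' {k}, F y ∂Q := by
  rw [← lintegral_iUnion (fun k => hσ (measurableSet_singleton k))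
    (fun i j hij => Disjoint.preimage σ (by simpa using hij))]
  have : ⋃ k, σ ⁻¹' {k} = univ := by ext; simp
  rw [this, Measure.restrict_univ]

lemma exists_lintegral_code {𝒞 : Set (Measure ℝ)} {S : ℝ → ℝ} {σ : ℝ → ℕ} (hS : Measurable S)
    (hσ : Measurable σ) (hsmul : ∀ Q ∈ 𝒞, ∀ c : ℝ≥0∞, c • Q ∈ 𝒞)
    (hsum : ∀ Q : ℕ → Measure ℝ, (∀ i, Q i ∈ 𝒞) → Measure.sum Q ∈ 𝒞)
    (hstep : ∀ Q ∈ 𝒞, ∀ k, ∃ Q' ∈ 𝒞, ∀ Ψ : ℝ → ℝ≥0∞, Measurable Ψ →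
      ∫⁻ y in σ ⁻¹' {k}, Ψ (S y) ∂Q = ∫⁻ x, Ψ x ∂Q') (n : ℕ) :
    ∀ Q ∈ 𝒞, ∀ g : List ℕ → ℝ≥0∞, ∃ Q' ∈ 𝒞, ∀ H : ℝ → ℝ≥0∞, Measurable H →
      ∫⁻ y, g (code S σ n y) * H (S^[n] y) ∂Q = ∫⁻ x, H x ∂Q' := by
  induction n with
  | zero =>
    intro Q hQ g
    refine ⟨_, hsmul Q hQ (g []), fun H hH => ?_⟩
    simp only [code, Function.iterate_zero, id]
    rw [lintegral_smul_measure, lintegral_const_mul _ hH, smul_eq_mul]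
  | succ n ih =>
    intro Q hQ g
    choose R hR hRe using hstep Q hQ
    choose R' hR' hRe' using fun k => ih (R k) (hR k) fun l => g (k :: l)
    refine ⟨_, hsum R' hR', fun H hH => ?_⟩
    rw [lintegral_eq_tsum_fiber hσ, lintegral_sum_measure]
    congr 1
    ext k
    rw [← hRe' k H hH, ← hRe k]
    · refine setLIntegral_congr_fun (hσ (measurableSet_singleton k)) fun y hy => ?_
      have hy' : σ y = k := hy
      simp only [code, hy', Function.iterate_succ_apply]
    · exact (measurable_comp_code hS hσ n fun l => g (k :: l)).mul (hH.comp (hS.iterate n))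

lemma measurable_half : Measurable half :=
  Measurable.ite measurableSet_Iio measurable_const measurable_const

lemma Cone.sum_mem {γ : ℝ} {Q : ℕ → Measure ℝ} (hQ : ∀ i, Q i ∈ Cone γ) :
    Measure.sum Q ∈ Cone γ := by
  choose h hh he using hQ
  refine ⟨_, ConeDensity.tsum hh, ?_⟩
  ext E hE
  simp only [Measure.sum_apply _ hE, he, withDensity_apply _ hE]
  rw [lintegral_tsum fun i => (hh i).1.aemeasurable]

lemma exists_lintegral_code_half {γ : ℝ} (hγ : γ ∈ Ioo (0 : ℝ) 1) (n : ℕ) {Q : Measure ℝ}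
    (hQ : Q ∈ Cone γ) (g : List ℕ → ℝ≥0∞) : ∃ Q' ∈ Cone γ, ∀ H : ℝ → ℝ≥0∞, Measurable H →
      ∫⁻ y, g (code (Tmap γ) half n y) * H ((Tmap γ)^[n] y) ∂Q = ∫⁻ x, H x ∂Q' := by
  refine exists_lintegral_code (measurable_Tmap γ) measurable_half
    (fun Q hQ c => Cone.smul_mem hQ c) (fun Q hQ => Cone.sum_mem hQ) (fun Q hQ k => ?_) n Q hQ g
  match k with
  | 0 =>
    refine ⟨_, pushL_mem_Cone hγ.1 hQ, fun Ψ hΨ => ?_⟩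
    have : half ⁻¹' {0} = Iio (1 / 2) := by ext y; simp [half]
    rw [this, lintegral_pushL γ Q hΨ]
  | 1 =>
    refine ⟨_, FlatCone_subset_Cone γ (pushR_mem_FlatCone hγ hQ), fun Ψ hΨ => ?_⟩
    have : half ⁻¹' {1} = Ici (1 / 2) := by ext y; simp [half]
    rw [this, lintegral_pushR γ Q hΨ]
  | k + 2 =>
    refine ⟨_, Cone.smul_mem hQ 0, fun Ψ _ => ?_⟩
    have : half ⁻¹' {k + 2} = ∅ := eq_empty_of_forall_notMem fun y hy => by
      have hy' : half y = k + 2 := hy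
      unfold half at hy'
      split_ifs at hy'
      omega
    simp [this]

/-! ### The first return to the right half -/

open Classical in
/-- One plus the first time at which the orbit visits the right half (`0` if it never does). -/
def returnTime (γ y : ℝ) : ℕ :=
  if h : ∃ k, 1 / 2 ≤ (Tmap γ)^[k] y then Nat.find h + 1 else 0

lemma returnTime_eq_succ_iff {γ y : ℝ} {k : ℕ} :
    returnTime γ y = k + 1 ↔ y ∈ stayLeft γ k ∧ 1 / 2 ≤ (Tmap γ)^[k] y := by
  classical
  unfold returnTime
  split_ifs with h
  · rw [Nat.add_right_cancel_iff, Nat.find_eq_iff, and_comm]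
    simp [stayLeft]
  · exact ⟨fun h' => h'.elim, fun h' => absurd ⟨k, h'.2⟩ h⟩

lemma returnTime_eq_zero_iff {γ y : ℝ} : returnTime γ y = 0 ↔ ∀ k, y ∈ stayLeft γ k := by
  classical
  unfold returnTime
  split_ifs with h
  · obtain ⟨k, hk⟩ := h
    exact ⟨fun h' => h'.elim,
      fun hc => absurd hk (hc (k + 1) k k.lt_succ_self).not_ge⟩
  · simp only [true_iff]
    push Not at h
    exact fun k i _ => h i

lemma stayLeft_of_le_returnTime {γ y : ℝ} {k : ℕ} (h : k < returnTime γ y) : y ∈ stayLeft γ k := by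
  obtain ⟨j, hj⟩ : ∃ j, returnTime γ y = j + 1 := ⟨returnTime γ y - 1, by omega⟩
  exact stayLeft_anti γ (by omega) (returnTime_eq_succ_iff.1 hj).1

lemma measurable_returnTime (γ : ℝ) : Measurable (returnTime γ) := by
  refine measurable_to_countable' fun k => ?_
  cases k with
  | zero =>
    have : returnTime γ ⁻¹' {0} = ⋂ k, stayLeft γ k := by
      ext y
      simp [returnTime_eq_zero_iff]
    rw [this]
    exact MeasurableSet.iInter fun k => measurableSet_stayLeft γ k
  | succ k =>
    have : returnTime γ ⁻¹' {k + 1} = stayLeft γ k ∩ (Tmap γ)^[k] ⁻¹' Ici (1 / 2) := by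
      ext y
      simp only [mem_preimage, mem_singleton_iff, returnTime_eq_succ_iff, mem_inter_iff, mem_Ici]
    rw [this]
    exact (measurableSet_stayLeft γ k).inter ((measurable_Tmap γ).iterate k measurableSet_Ici)

/-- The map induced by `Tmap γ` at the first passage through the right half. -/
def inducedMap (γ y : ℝ) : ℝ := (Tmap γ)^[returnTime γ y] y

lemma measurable_inducedMap (γ : ℝ) : Measurable (inducedMap γ) := by
  intro E hE
  have : inducedMap γ ⁻¹' E = ⋃ k, returnTime γ ⁻¹' {k} ∩ (Tmap γ)^[k] ⁻¹' E := by
    ext y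
    simp [inducedMap]
  rw [this]
  exact MeasurableSet.iUnion fun k => (measurable_returnTime γ (measurableSet_singleton k)).inter
    ((measurable_Tmap γ).iterate k hE)

lemma setLIntegral_inducedMap (γ : ℝ) (k : ℕ) {Ψ : ℝ → ℝ≥0∞} (hΨ : Measurable Ψ) :
    ∀ Q : Measure ℝ, ∫⁻ y in returnTime γ ⁻¹' {k + 1}, Ψ (inducedMap γ y) ∂Q =
      ∫⁻ x, Ψ x ∂(pushR γ ((pushL γ)^[k] Q)) := by
  intro Q
  have h1 : ∫⁻ y in returnTime γ ⁻¹' {k + 1}, Ψ (inducedMap γ y) ∂Q =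
      ∫⁻ y in returnTime γ ⁻¹' {k + 1}, Ψ ((Tmap γ)^[k + 1] y) ∂Q :=
    setLIntegral_congr_fun (measurable_returnTime γ (measurableSet_singleton _)) fun y hy => by
      have hy' : returnTime γ y = k + 1 := hy
      simp only [inducedMap, hy']
  rw [h1]
  clear h1
  induction k generalizing Q with
  | zero =>
    have : returnTime γ ⁻¹' {0 + 1} = Ici (1 / 2) := by
      ext y
      simp only [mem_preimage, mem_singleton_iff, returnTime_eq_succ_iff, mem_Ici]
      simp [stayLeft]
    rw [this, Function.iterate_zero, id, lintegral_pushR γ Q hΨ]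
    rfl
  | succ k ih =>
    have hD : returnTime γ ⁻¹' {k + 1 + 1} =
        Tmap γ ⁻¹' (returnTime γ ⁻¹' {k + 1}) ∩ Iio (1 / 2) := by
      ext y
      simp only [mem_preimage, mem_singleton_iff, returnTime_eq_succ_iff, mem_inter_iff, mem_Iio,
        stayLeft_succ, Function.iterate_succ_apply]
      tauto
    have hm := measurable_returnTime γ (measurableSet_singleton (k + 1))
    have hH : Measurable fun y => Ψ ((Tmap γ)^[k + 1] y) :=
      hΨ.comp ((measurable_Tmap γ).iterate _)
    rw [Function.iterate_succ_apply, ← ih, pushL, setLIntegral_map hm hH (measurable_Tmap γ),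
      Measure.restrict_restrict (measurable_Tmap γ hm), ← hD]
    rfl

lemma Cone.absolutelyContinuous {γ : ℝ} {Q : Measure ℝ} (hQ : Q ∈ Cone γ) : Q ≪ unitLeb := by
  obtain ⟨h, _, rfl⟩ := hQ
  exact withDensity_absolutelyContinuous _ _

lemma unitLeb_returnTime_eq_zero {γ : ℝ} (hγ : γ ∈ Ioo (0 : ℝ) 1) :
    unitLeb (returnTime γ ⁻¹' {0}) = 0 := by
  refine le_antisymm (ge_of_tendsto' (tendsto_unitLeb_stayLeft hγ) fun k =>
    measure_mono fun y hy => ?_) zero_le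
  exact returnTime_eq_zero_iff.1 hy k

lemma iterate_pushL_mem_Cone {γ : ℝ} (hγ : 0 < γ) (k : ℕ) :
    ∀ Q ∈ Cone γ, (pushL γ)^[k] Q ∈ Cone γ := by
  induction k with
  | zero => exact fun Q hQ => hQ
  | succ k ih =>
      intro Q hQ
      rw [Function.iterate_succ_apply']
      exact pushL_mem_Cone hγ (ih Q hQ)

lemma exists_setLIntegral_inducedMap {γ : ℝ} (hγ : γ ∈ Ioo (0 : ℝ) 1) {Q : Measure ℝ}
    (hQ : Q ∈ Cone γ) (k : ℕ) : ∃ Q' ∈ FlatCone γ, ∀ Ψ : ℝ → ℝ≥0∞, Measurable Ψ →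
      ∫⁻ y in returnTime γ ⁻¹' {k}, Ψ (inducedMap γ y) ∂Q = ∫⁻ x, Ψ x ∂Q' := by
  cases k with
  | zero =>
    refine ⟨_, FlatCone.smul_mem (unitLeb_mem_FlatCone hγ.1) 0, fun Ψ _ => ?_⟩
    have : Q (returnTime γ ⁻¹' {0}) = 0 :=
      Cone.absolutelyContinuous hQ (unitLeb_returnTime_eq_zero hγ)
    simp [setLIntegral_measure_zero _ _ this]
  | succ k => exact ⟨_, pushR_mem_FlatCone hγ (iterate_pushL_mem_Cone hγ.1 k Q hQ),
      fun Ψ hΨ => setLIntegral_inducedMap γ k hΨ Q⟩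

lemma exists_lintegral_code_returnTime {γ : ℝ} (hγ : γ ∈ Ioo (0 : ℝ) 1) (n : ℕ) {Q : Measure ℝ}
    (hQ : Q ∈ FlatCone γ) (g : List ℕ → ℝ≥0∞) : ∃ Q' ∈ FlatCone γ, ∀ H : ℝ → ℝ≥0∞,
      Measurable H → ∫⁻ y, g (code (inducedMap γ) (returnTime γ) n y) *
        H ((inducedMap γ)^[n] y) ∂Q = ∫⁻ x, H x ∂Q' :=
  exists_lintegral_code (measurable_inducedMap γ) (measurable_returnTime γ)
    (fun _ hQ c => FlatCone.smul_mem hQ c) (fun _ hQ => FlatCone.sum_mem hQ)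
    (fun _ hQ k => exists_setLIntegral_inducedMap hγ (FlatCone_subset_Cone γ hQ) k) n Q hQ g

lemma map_inducedMap_mem_FlatCone {γ : ℝ} (hγ : γ ∈ Ioo (0 : ℝ) 1) {Q : Measure ℝ}
    (hQ : Q ∈ Cone γ) : Q.map (inducedMap γ) ∈ FlatCone γ := by
  choose R hR hRe using exists_setLIntegral_inducedMap hγ hQ
  have : Q.map (inducedMap γ) = Measure.sum R := by
    refine Measure.ext_of_lintegral _ fun Ψ hΨ => ?_
    rw [lintegral_map hΨ (measurable_inducedMap γ), lintegral_sum_measure,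
      lintegral_eq_tsum_fiber (measurable_returnTime γ)]
    exact tsum_congr fun k => hRe k Ψ hΨ
  rw [this]
  exact FlatCone.sum_mem hR

/-! ### Invariant measures as limits of the cone -/

lemma exists_Cone_approx {γ : ℝ} (hγ : γ ∈ Ioo (0 : ℝ) 1) {ν : Measure ℝ} [IsFiniteMeasure ν]
    (hac : ν ≪ unitLeb) (hinv : ν.map (Tmap γ) = ν) {ε : ℝ} (hε : 0 < ε) :
    ∃ Q ∈ Cone γ, ∀ E, MeasurableSet E →
      ν E ≤ Q E + ENNReal.ofReal ε ∧ Q E ≤ ν E + ENNReal.ofReal ε := by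
  set h := ν.rnDeriv unitLeb with hh
  have hνh : ν = unitLeb.withDensity h := (Measure.withDensity_rnDeriv_eq _ _ hac).symm
  have hhm : Measurable h := Measure.measurable_rnDeriv _ _
  have hhfin : ∀ᵐ y ∂unitLeb, h y < ∞ := Measure.rnDeriv_lt_top _ _
  have hint : Integrable (fun y => (h y).toReal) unitLeb := Measure.integrable_toReal_rnDeriv
  have hreg : unitLeb.Regular := inferInstance
  obtain ⟨g, -, hg, hgc, -⟩ := hint.exists_hasCompactSupport_lintegral_sub_le
    (ε := ENNReal.ofReal (ε / 2)) (by simpa using hε)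
  have huc := (isCompact_Icc (a := (0 : ℝ)) (b := 1)).uniformContinuousOn_of_continuous
    hgc.continuousOn
  obtain ⟨δ, hδ, hδg⟩ := Metric.uniformContinuousOn_iff.1 huc (ε / 2) (by positivity)
  obtain ⟨m, hmδ, hm⟩ := (((tendsto_order.1 (tendsto_expansion_bound hγ.1)).2 δ hδ).and
    (eventually_gt_atTop 0)).exists
  classical
  let c := code (Tmap γ) half m
  let rep : List ℕ → ℝ := fun l => if hl : ∃ y ∈ Ico (0 : ℝ) 1, c y = l then hl.choose else 0
  have hrep : ∀ y ∈ Ioo (0 : ℝ) 1, |g y - g (rep (c y))| ≤ ε / 2 := by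
    intro y hy
    have hy' : y ∈ Ico (0 : ℝ) 1 := ⟨hy.1.le, hy.2⟩
    have hl : ∃ y' ∈ Ico (0 : ℝ) 1, c y' = c y := ⟨y, hy', rfl⟩
    have he : rep (c y) = hl.choose := dif_pos hl
    obtain ⟨h1, h2⟩ := hl.choose_spec
    rw [he]
    have hd := dist_le_of_code_eq hγ hm hy' h1 h2.symm
    exact (hδg y ⟨hy.1.le, hy.2.le⟩ _ ⟨h1.1, h1.2.le⟩ (hd.trans_lt hmδ)).le
  let ψ : List ℕ → ℝ≥0∞ := fun l => ENNReal.ofReal (g (rep l))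
  obtain ⟨Q, hQ, hQe⟩ := exists_lintegral_code_half hγ m
    (FlatCone_subset_Cone γ (unitLeb_mem_FlatCone hγ.1)) ψ
  refine ⟨Q, hQ, fun E hE => ?_⟩
  let D := (Tmap γ)^[m] ⁻¹' E
  have hD : MeasurableSet D := (measurable_Tmap γ).iterate m hE
  have hνE : ν E = ∫⁻ y in D, h y ∂unitLeb := by
    rw [← withDensity_apply _ hD, ← hνh]
    have hmp : MeasurePreserving (Tmap γ) ν ν := ⟨measurable_Tmap γ, hinv⟩
    exact ((hmp.iterate m).measure_preimage hE.nullMeasurableSet).symm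
  have hQE : Q E = ∫⁻ y in D, ψ (c y) ∂unitLeb := by
    rw [← lintegral_indicator_one hE, ← hQe _ (measurable_one.indicator hE),
      ← lintegral_indicator hD]
    congr 1
    ext y
    simp only [indicator, mem_preimage, D, Pi.one_apply]
    split_ifs <;> simp [c]
  let r : ℝ → ℝ≥0∞ := fun y => ‖(h y).toReal - g y‖ₑ + ENNReal.ofReal (ε / 2)
  have hψm : Measurable fun y => ψ (c y) :=
    measurable_comp_code (measurable_Tmap γ) measurable_half m ψ
  have hr : ∫⁻ y in D, r y ∂unitLeb ≤ ENNReal.ofReal ε := by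
    calc ∫⁻ y in D, r y ∂unitLeb ≤ ∫⁻ y, r y ∂unitLeb := setLIntegral_le_lintegral _ _
      _ = (∫⁻ y, ‖(h y).toReal - g y‖ₑ ∂unitLeb) + ENNReal.ofReal (ε / 2) := by
        rw [lintegral_add_right _ measurable_const]
        simp
      _ ≤ ENNReal.ofReal (ε / 2) + ENNReal.ofReal (ε / 2) := by gcongr
      _ = ENNReal.ofReal ε := by
        rw [← ENNReal.ofReal_add (by positivity) (by positivity), add_halves]
  have key : ∀ᵐ y ∂unitLeb, h y ≤ ψ (c y) + r y ∧ ψ (c y) ≤ h y + r y := by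
    filter_upwards [hhfin, ae_restrict_mem measurableSet_Ioo] with y hy1 hy2
    have h3 := abs_le.1 (hrep y hy2)
    have h4 := le_abs_self ((h y).toReal - g y)
    have h5 := neg_abs_le ((h y).toReal - g y)
    have hrr : r y = ENNReal.ofReal (|(h y).toReal - g y| + ε / 2) := by
      rw [ENNReal.ofReal_add (abs_nonneg _) (by positivity), ← Real.enorm_eq_ofReal_abs]
    have hpos : 0 ≤ |(h y).toReal - g y| + ε / 2 := by positivity
    constructor
    · calc h y = ENNReal.ofReal (h y).toReal := (ENNReal.ofReal_toReal hy1.ne).symm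
        _ ≤ ENNReal.ofReal (g (rep (c y)) + (|(h y).toReal - g y| + ε / 2)) :=
          ENNReal.ofReal_le_ofReal (by linarith)
        _ ≤ _ := by rw [hrr]; exact ENNReal.ofReal_add_le
    · calc ψ (c y) ≤ ENNReal.ofReal ((h y).toReal + (|(h y).toReal - g y| + ε / 2)) :=
          ENNReal.ofReal_le_ofReal (by linarith)
        _ ≤ _ := by
          rw [hrr]
          refine ENNReal.ofReal_add_le.trans_eq ?_
          rw [ENNReal.ofReal_toReal hy1.ne]
  rw [hνE, hQE]
  constructor
  · calc _ ≤ ∫⁻ y in D, (ψ (c y) + r y) ∂unitLeb :=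
        lintegral_mono_ae (ae_restrict_of_ae (key.mono fun _ hy => hy.1))
      _ = (∫⁻ y in D, ψ (c y) ∂unitLeb) + ∫⁻ y in D, r y ∂unitLeb := lintegral_add_left hψm _
      _ ≤ _ := by gcongr
  · calc _ ≤ ∫⁻ y in D, (h y + r y) ∂unitLeb :=
        lintegral_mono_ae (ae_restrict_of_ae (key.mono fun _ hy => hy.2))
      _ = (∫⁻ y in D, h y ∂unitLeb) + ∫⁻ y in D, r y ∂unitLeb := lintegral_add_left hhm _
      _ ≤ _ := by gcongr

lemma exists_Cone_tendsto {γ : ℝ} (hγ : γ ∈ Ioo (0 : ℝ) 1) {ν : Measure ℝ} [IsFiniteMeasure ν]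
    (hac : ν ≪ unitLeb) (hinv : ν.map (Tmap γ) = ν) :
    ∃ Q : ℕ → Measure ℝ, (∀ n, Q n ∈ Cone γ) ∧
      ∀ E, MeasurableSet E → Tendsto (fun n => Q n E) atTop (𝓝 (ν E)) := by
  choose Q hQ hQe using fun n : ℕ => exists_Cone_approx hγ hac hinv
    (ε := 1 / ((n : ℝ) + 1)) Nat.one_div_pos_of_nat
  refine ⟨Q, hQ, fun E hE => ?_⟩
  have h0 : Tendsto (fun n : ℕ => ENNReal.ofReal (1 / ((n : ℝ) + 1))) atTop (𝓝 0) := by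
    simpa using ENNReal.tendsto_ofReal (tendsto_one_div_add_atTop_nhds_zero_nat (𝕜 := ℝ))
  refine tendsto_of_tendsto_of_tendsto_of_le_of_le
    (g := fun n : ℕ => ν E - ENNReal.ofReal (1 / ((n : ℝ) + 1)))
    (h := fun n : ℕ => ν E + ENNReal.ofReal (1 / ((n : ℝ) + 1))) ?_ ?_
    (fun n => tsub_le_iff_right.2 (hQe n E hE).1) fun n => (hQe n E hE).2
  · simpa using ENNReal.Tendsto.sub (tendsto_const_nhds (x := ν E)) h0
      (Or.inl (measure_ne_top ν E))
  · simpa using (tendsto_const_nhds (x := ν E)).add h0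

section Invariant

variable {γ : ℝ} {ν : Measure ℝ}

lemma measure_right_mul_le [IsFiniteMeasure ν] (hγ : γ ∈ Ioo (0 : ℝ) 1) (hac : ν ≪ unitLeb)
    (hinv : ν.map (Tmap γ) = ν) {E : Set ℝ} (hE : MeasurableSet E) :
    ν (Ici (1 / 2)) * unitLeb E ≤ 4 * ν (Tmap γ ⁻¹' E ∩ Ici (1 / 2)) := by
  obtain ⟨Q, hQ, hQt⟩ := exists_Cone_tendsto hγ hac hinv
  have hTE := measurable_Tmap γ hE
  refine le_of_tendsto_of_tendsto'
    (ENNReal.Tendsto.mul_const (hQt _ measurableSet_Ici) (Or.inr (measure_ne_top _ _)))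
    (ENNReal.Tendsto.const_mul (hQt _ (hTE.inter measurableSet_Ici)) (Or.inr (by simp)))
    fun n => ?_
  have h := FlatCone.le_apply (pushR_mem_FlatCone hγ (hQ n)) hE
  rwa [pushR, Measure.map_apply (measurable_Tmap γ) hE, Measure.map_apply (measurable_Tmap γ) .univ,
    Measure.restrict_apply hTE, preimage_univ, Measure.restrict_apply_univ] at h

lemma measure_right_le_mul [IsFiniteMeasure ν] (hγ : γ ∈ Ioo (0 : ℝ) 1) (hac : ν ≪ unitLeb)
    (hinv : ν.map (Tmap γ) = ν) {E : Set ℝ} (hE : MeasurableSet E) :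
    ν (Tmap γ ⁻¹' E ∩ Ici (1 / 2)) ≤ 4 * ν (Ici (1 / 2)) * unitLeb E := by
  obtain ⟨Q, hQ, hQt⟩ := exists_Cone_tendsto hγ hac hinv
  have hTE := measurable_Tmap γ hE
  refine le_of_tendsto_of_tendsto' (hQt _ (hTE.inter measurableSet_Ici))
    (ENNReal.Tendsto.mul_const (ENNReal.Tendsto.const_mul (hQt _ measurableSet_Ici)
      (Or.inr (by simp))) (Or.inr (measure_ne_top _ _))) fun n => ?_
  have h := FlatCone.apply_le (pushR_mem_FlatCone hγ (hQ n)) hE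
  rwa [pushR, Measure.map_apply (measurable_Tmap γ) hE, Measure.map_apply (measurable_Tmap γ) .univ,
    Measure.restrict_apply hTE, preimage_univ, Measure.restrict_apply_univ] at h

lemma measure_inducedMap_preimage_le [IsFiniteMeasure ν] (hγ : γ ∈ Ioo (0 : ℝ) 1) (hac : ν ≪ unitLeb)
    (hinv : ν.map (Tmap γ) = ν) {E : Set ℝ} (hE : MeasurableSet E) :
    ν (inducedMap γ ⁻¹' E) ≤ 4 * ν univ * unitLeb E := by
  obtain ⟨Q, hQ, hQt⟩ := exists_Cone_tendsto hγ hac hinv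
  refine le_of_tendsto_of_tendsto' (hQt _ (measurable_inducedMap γ hE))
    (ENNReal.Tendsto.mul_const (ENNReal.Tendsto.const_mul (hQt _ .univ)
      (Or.inr (by simp))) (Or.inr (measure_ne_top _ _))) fun n => ?_
  have h := FlatCone.apply_le (map_inducedMap_mem_FlatCone hγ (hQ n)) hE
  rwa [Measure.map_apply (measurable_inducedMap γ) hE,
    Measure.map_apply (measurable_inducedMap γ) .univ, preimage_univ] at h

lemma measure_stayLeft_inter (hinv : ν.map (Tmap γ) = ν) (k : ℕ) {B : Set ℝ}
    (hB : MeasurableSet B) :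
    ν (stayLeft γ k ∩ (Tmap γ)^[k] ⁻¹' B) =
      ν (stayLeft γ (k + 1) ∩ (Tmap γ)^[k + 1] ⁻¹' B) +
        ν (Tmap γ ⁻¹' (stayLeft γ k ∩ (Tmap γ)^[k] ⁻¹' B) ∩ Ici (1 / 2)) := by
  have hm : MeasurableSet (stayLeft γ k ∩ (Tmap γ)^[k] ⁻¹' B) :=
    (measurableSet_stayLeft γ k).inter ((measurable_Tmap γ).iterate k hB)
  conv_lhs => rw [← hinv, Measure.map_apply (measurable_Tmap γ) hm]
  rw [← measure_inter_add_sdiff _ (measurableSet_Iio (a := (1 / 2 : ℝ)))]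
  congr 2
  · rw [stayLeft_succ, preimage_inter, Function.iterate_succ, preimage_comp]
    ext y
    simp only [mem_inter_iff]
    tauto
  · ext y
    simp

lemma tendsto_measure_stayLeft [IsFiniteMeasure ν] (hγ : γ ∈ Ioo (0 : ℝ) 1) (hac : ν ≪ unitLeb) :
    Tendsto (fun k => ν (stayLeft γ k)) atTop (𝓝 0) := by
  have h0 : ν (⋂ k, stayLeft γ k) = 0 := by
    refine hac (measure_mono_null (fun y hy => ?_) (unitLeb_returnTime_eq_zero hγ))
    exact returnTime_eq_zero_iff.2 (mem_iInter.1 hy)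
  rw [← h0]
  exact tendsto_measure_iInter_atTop
    (fun k => (measurableSet_stayLeft γ k).nullMeasurableSet) (stayLeft_anti γ)
    ⟨0, measure_ne_top _ _⟩

lemma sum_measure_right_le (hinv : ν.map (Tmap γ) = ν) {B : Set ℝ} (hB : MeasurableSet B)
    (K : ℕ) :
    ∑ k ∈ Finset.range K, ν (Tmap γ ⁻¹' (stayLeft γ k ∩ (Tmap γ)^[k] ⁻¹' B) ∩ Ici (1 / 2)) +
      ν (stayLeft γ K ∩ (Tmap γ)^[K] ⁻¹' B) = ν B := by
  induction K with
  | zero => simp [stayLeft]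
  | succ K ih =>
    rw [← ih, measure_stayLeft_inter hinv K hB, Finset.sum_range_succ]
    ring

lemma sum_unitLeb_visits_le [IsFiniteMeasure ν] (hγ : γ ∈ Ioo (0 : ℝ) 1) (hac : ν ≪ unitLeb)
    (hinv : ν.map (Tmap γ) = ν) {B : Set ℝ} (hB : MeasurableSet B) (K : ℕ) :
    ν (Ici (1 / 2)) * ∑ k ∈ Finset.range K, unitLeb (stayLeft γ k ∩ (Tmap γ)^[k] ⁻¹' B) ≤
      4 * ν B := by
  rw [← sum_measure_right_le hinv hB K, mul_add, Finset.mul_sum, Finset.mul_sum]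
  refine le_add_right (Finset.sum_le_sum fun k _ => measure_right_mul_le hγ hac hinv ?_)
  exact (measurableSet_stayLeft γ k).inter ((measurable_Tmap γ).iterate k hB)

lemma measure_stayLeft_le_tsum [IsFiniteMeasure ν] (hγ : γ ∈ Ioo (0 : ℝ) 1) (hac : ν ≪ unitLeb)
    (hinv : ν.map (Tmap γ) = ν) (m : ℕ) :
    ν (stayLeft γ m) ≤ 4 * ν univ * ∑' j, unitLeb (stayLeft γ (m + j)) := by
  have hstep : ∀ K, ν (stayLeft γ m) ≤
      ν (stayLeft γ (m + K)) +
        4 * ν univ * ∑ j ∈ Finset.range K, unitLeb (stayLeft γ (m + j)) := by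
    intro K
    induction K with
    | zero => simp
    | succ K ih =>
      refine ih.trans ?_
      have h := measure_stayLeft_inter hinv (m + K) .univ
      simp only [preimage_univ, inter_univ] at h
      rw [h, Finset.sum_range_succ, mul_add, add_assoc, ← add_assoc m K 1]
      refine add_le_add_right ?_ _
      rw [add_comm]
      refine add_le_add_right ?_ _
      refine (measure_right_le_mul hγ hac hinv (measurableSet_stayLeft γ _)).trans ?_
      gcongr
      exact subset_univ _
  have ht := ((tendsto_measure_stayLeft (ν := ν) hγ hac).comp (tendsto_add_atTop_nat m)).add_const
    (4 * ν univ * ∑' j, unitLeb (stayLeft γ (m + j)))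
  rw [zero_add] at ht
  refine ge_of_tendsto' ht fun K => (hstep K).trans ?_
  rw [Function.comp, add_comm K m]
  gcongr
  exact ENNReal.sum_le_tsum _

lemma measure_right_ne_zero [IsFiniteMeasure ν] (hγ : γ ∈ Ioo (0 : ℝ) 1) (hac : ν ≪ unitLeb)
    (hinv : ν.map (Tmap γ) = ν) (hν : ν univ ≠ 0) : ν (Ici (1 / 2)) ≠ 0 := by
  intro h0
  have h : ∀ k, ν (stayLeft γ k) = ν univ := by
    intro k
    rw [← sum_measure_right_le hinv .univ k, preimage_univ, inter_univ,
      Finset.sum_eq_zero fun j _ => measure_mono_null inter_subset_right h0, zero_add]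
  exact hν (tendsto_nhds_unique (by simp_rw [h]; exact tendsto_const_nhds)
    (tendsto_measure_stayLeft (ν := ν) hγ hac))

end Invariant
lemma ergodic_Tmap {γ : ℝ} (hγ : γ ∈ Ioo (0 : ℝ) 1) {ν : Measure ℝ} [IsFiniteMeasure ν]
    (hac : ν ≪ unitLeb) (hinv : ν.map (Tmap γ) = ν) : Ergodic (Tmap γ) ν where
  measurable := measurable_Tmap γ
  map_eq := hinv
  aeconst_set := by
    intro s hs hTs
    rw [eventuallyConst_set]
    by_cases h0 : ν s = 0
    · exact Or.inr (measure_eq_zero_iff_ae_notMem.1 h0)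
    left
    have hinv' : (ν.restrict s).map (Tmap γ) = ν.restrict s := by
      have h := (MeasurePreserving.mk (measurable_Tmap γ) hinv).restrict_preimage hs
      rw [hTs] at h
      exact h.map_eq
    have hac' : ν.restrict s ≪ unitLeb := Measure.restrict_le_self.absolutelyContinuous.trans hac
    have h1 := measure_right_mul_le hγ hac' hinv' hs.compl
    have h2 := measure_right_ne_zero hγ hac' hinv' (by simpa using h0)
    have h3 : ν.restrict s (Tmap γ ⁻¹' sᶜ ∩ Ici (1 / 2)) = 0 := by
      refine measure_mono_null inter_subset_left ?_
      rw [preimage_compl, hTs, Measure.restrict_apply hs.compl]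
      simp
    rw [h3, mul_zero, nonpos_iff_eq_zero, mul_eq_zero] at h1
    exact (measure_eq_zero_iff_ae_notMem.1 (hac (h1.resolve_left h2))).mono fun y hy => by
      simpa using hy

lemma exists_measure_birkhoffSum_ge_le {α : Type*} [MeasurableSpace α] {μ : Measure α}
    [IsProbabilityMeasure μ] {T : α → α} (hT : Ergodic T μ) {φ : α → ℝ} (hφ : MemLp φ 2 μ)
    (hφ0 : ∫ y, φ y ∂μ = 0) {η : ℝ} (hη : 0 < η) {θ : ℝ≥0∞} (hθ : 0 < θ) :
    ∃ L : ℕ, 0 < L ∧ μ {y | η * L ≤ |∑ i ∈ Finset.range L, φ (T^[i] y)|} ≤ θ := by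
  have hmp := hT.toMeasurePreserving
  set U : Lp ℝ 2 μ →L[ℝ] Lp ℝ 2 μ :=
    (Lp.compMeasurePreservingₗᵢ ℝ T hmp).toContinuousLinearMap
  have hproj : (U.eqLocus (1 : Lp ℝ 2 μ →L[ℝ] Lp ℝ 2 μ)).orthogonalProjectionOnto (hφ.toLp φ)
      = 0 := by
    rw [Submodule.orthogonalProjectionOnto_eq_zero_iff, Submodule.mem_orthogonal]
    intro w hw
    have hw' : Lp.compMeasurePreserving T hmp w = w := hw
    have hcomp : (w : α → ℝ) ∘ T =ᵐ[μ] w := by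
      refine (Lp.coeFn_compMeasurePreserving w hmp).symm.trans ?_
      rw [hw']
    obtain ⟨c, hc⟩ := hT.ae_eq_const_of_ae_eq_comp_ae (Lp.aestronglyMeasurable w) hcomp
    rw [L2.inner_def]
    have : (fun a => inner ℝ (w a) (hφ.toLp φ a)) =ᵐ[μ] fun a => c * φ a := by
      filter_upwards [hc, hφ.coeFn_toLp] with a ha hb
      rw [ha, hb]
      simp [mul_comm]
    rw [integral_congr_ae this, integral_const_mul, hφ0, mul_zero]
  have hlim := U.tendsto_birkhoffAverage_orthogonalProjection
    (LinearIsometry.norm_toContinuousLinearMap_le _) (hφ.toLp φ)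
  rw [hproj, ZeroMemClass.coe_zero] at hlim
  have hmeas := tendstoInMeasure_of_tendsto_Lp hlim
  have hcoe : ∀ L : ℕ, ((birkhoffAverage ℝ U _root_.id L (hφ.toLp φ) : Lp ℝ 2 μ) : α → ℝ) =ᵐ[μ]
      fun y => (L : ℝ)⁻¹ * ∑ i ∈ Finset.range L, φ (T^[i] y) := by
    intro L
    have hit : ∀ i, U^[i] (hφ.toLp φ) =
        (hφ.comp_measurePreserving (hmp.iterate i)).toLp (φ ∘ T^[i]) := by
      intro i
      have : (U : Lp ℝ 2 μ → Lp ℝ 2 μ) = Lp.compMeasurePreserving T hmp := rfl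
      rw [this, Lp.compMeasurePreserving_iterate, Lp.toLp_compMeasurePreserving]
    have hsum : ∀ N, ((∑ i ∈ Finset.range N, U^[i] (hφ.toLp φ) : Lp ℝ 2 μ) : α → ℝ) =ᵐ[μ]
        fun y => ∑ i ∈ Finset.range N, φ (T^[i] y) := by
      intro N
      induction N with
      | zero =>
        simp only [Finset.range_zero, Finset.sum_empty]
        exact Lp.coeFn_zero ℝ 2 μ
      | succ N ih =>
        rw [Finset.sum_range_succ]
        refine (Lp.coeFn_add _ _).trans ?_
        rw [hit N]
        filter_upwards [ih, (hφ.comp_measurePreserving (hmp.iterate N)).coeFn_toLp] with y h1 h2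
        rw [Pi.add_apply, h1, h2, Finset.sum_range_succ, Function.comp_apply]
    have : birkhoffAverage ℝ U _root_.id L (hφ.toLp φ) =
        (L : ℝ)⁻¹ • ∑ i ∈ Finset.range L, U^[i] (hφ.toLp φ) := rfl
    rw [this]
    filter_upwards [Lp.coeFn_smul (L : ℝ)⁻¹ (∑ i ∈ Finset.range L, U^[i] (hφ.toLp φ)), hsum L]
      with y h1 h2
    rw [h1, Pi.smul_apply, h2, smul_eq_mul]
  have hev := (hmeas (ENNReal.ofReal η) (by simpa using hη)).eventually (gt_mem_nhds hθ)
  obtain ⟨L, hL, hL0⟩ := (hev.and (eventually_gt_atTop 0)).exists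
  refine ⟨L, hL0, le_trans (measure_mono_ae ?_) hL.le⟩
  filter_upwards [hcoe L, Lp.coeFn_zero ℝ 2 μ] with y h1 h2 hy
  change ENNReal.ofReal η ≤ edist _ _
  have hy' : η * L ≤ |∑ i ∈ Finset.range L, φ (T^[i] y)| := hy
  have hLp : (0 : ℝ) < L := by exact_mod_cast hL0
  rw [edist_dist, Real.dist_eq]
  refine ENNReal.ofReal_le_ofReal ?_
  rw [h1, h2, Pi.zero_apply, sub_zero, abs_mul, abs_inv, Nat.abs_cast, inv_mul_eq_div,
    le_div_iff₀ hLp]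
  exact hy'

lemma exists_measure_stayLeft_le_rpow {γ : ℝ} (hγ : γ ∈ Ioo (0 : ℝ) 1) {ν : Measure ℝ}
    [IsProbabilityMeasure ν] (hac : ν ≪ unitLeb) (hinv : ν.map (Tmap γ) = ν) {e : ℝ}
    (he : 0 < e) (he' : e ≤ (1 - γ) / γ) :
    ∃ C : ℝ, 0 < C ∧ ∀ m : ℕ, 0 < m →
      ν (stayLeft γ m) ≤ ENNReal.ofReal (C * (m : ℝ) ^ (-(1 - γ) / γ + e)) := by
  have hγ0 := hγ.1
  set c := (γ / 2) ^ (-(1 / γ)) with hc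
  have hc0 : 0 < c := by positivity
  have hsum : Summable fun j : ℕ => ((j + 1 : ℕ) : ℝ) ^ (-1 - e) :=
    (summable_nat_add_iff 1).2 (Real.summable_nat_rpow.2 (by linarith))
  set Z := ∑' j : ℕ, ((j + 1 : ℕ) : ℝ) ^ (-1 - e) with hZ
  have hZ0 : 0 ≤ Z := tsum_nonneg fun j => by positivity
  refine ⟨4 * c * Z + 1, by positivity, fun m hm => ?_⟩
  have hm0 : (0 : ℝ) < m := by exact_mod_cast hm
  have hexp : -(1 / γ) = (-1 - e) + (-(1 - γ) / γ + e) := by field_simp; ring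
  have hterm : ∀ j : ℕ, unitLeb (stayLeft γ (m + j)) ≤
      ENNReal.ofReal (c * (m : ℝ) ^ (-(1 - γ) / γ + e)) *
        ENNReal.ofReal (((j + 1 : ℕ) : ℝ) ^ (-1 - e)) := by
    intro j
    refine (unitLeb_stayLeft_le hγ (by omega)).trans ?_
    rw [← ENNReal.ofReal_mul (by positivity)]
    refine ENNReal.ofReal_le_ofReal ?_
    have hk0 : (0 : ℝ) < (m + j : ℕ) := by exact_mod_cast (by omega : 0 < m + j)
    rw [Real.mul_rpow hk0.le (by positivity), ← hc, mul_comm _ c, mul_assoc]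
    refine mul_le_mul_of_nonneg_left ?_ hc0.le
    rw [hexp, Real.rpow_add hk0, mul_comm]
    refine mul_le_mul ?_ ?_ (by positivity) (by positivity)
    · refine Real.rpow_le_rpow_of_nonpos hm0 (by exact_mod_cast (by omega : m ≤ m + j)) ?_
      rw [neg_div]
      linarith
    · exact Real.rpow_le_rpow_of_nonpos (by positivity)
        (by exact_mod_cast (by omega : j + 1 ≤ m + j)) (by linarith)
  refine (measure_stayLeft_le_tsum hγ hac hinv m).trans ?_
  rw [measure_univ, mul_one]
  calc 4 * ∑' j, unitLeb (stayLeft γ (m + j))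
      ≤ 4 * (ENNReal.ofReal (c * (m : ℝ) ^ (-(1 - γ) / γ + e)) * ENNReal.ofReal Z) := by
        gcongr
        refine (ENNReal.tsum_le_tsum hterm).trans ?_
        rw [ENNReal.tsum_mul_left, hZ,
          ENNReal.ofReal_tsum_of_nonneg (fun j => by positivity) hsum]
    _ = ENNReal.ofReal (4 * c * Z * (m : ℝ) ^ (-(1 - γ) / γ + e)) := by
        rw [← ENNReal.ofReal_mul (by positivity),
          show (4 : ℝ≥0∞) = ENNReal.ofReal 4 by norm_num,
          ← ENNReal.ofReal_mul (by norm_num)]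
        congr 1
        ring
    _ ≤ _ := by
        refine ENNReal.ofReal_le_ofReal ?_
        gcongr
        linarith

lemma continuousAt_Tmap {γ : ℝ} (hγ : 0 < γ) {y : ℝ} (h0 : 0 < y) (h1 : y ≠ 1 / 2) :
    ContinuousAt (Tmap γ) y := by
  rcases h1.lt_or_gt with h | h
  · refine (continuous_leftBranch hγ).continuousAt.congr ?_
    filter_upwards [Ioo_mem_nhds h0 h] with z hz using (Tmap_of_lt hγ hz.1.le hz.2).symm
  · have : ContinuousAt (fun z : ℝ => 2 * z - 1) y := by fun_prop
    refine this.congr ?_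
    filter_upwards [Ioi_mem_nhds h] with z hz using (Tmap_of_ge (le_of_lt hz)).symm

lemma ae_continuousAt_Sn {γ : ℝ} (hγ : 0 < γ) {ν : Measure ℝ} (hac : ν ≪ unitLeb)
    (hinv : ν.map (Tmap γ) = ν) {g : ℝ → ℝ} (hg : ∀ᵐ y ∂unitLeb, ContinuousAt g y) (L : ℕ) :
    ∀ᵐ y ∂ν, ContinuousAt (Sn γ g L) y := by
  have hmp : MeasurePreserving (Tmap γ) ν ν := ⟨measurable_Tmap γ, hinv⟩
  have hgood : ∀ᵐ y ∂unitLeb, (0 < y ∧ y ≠ 1 / 2) ∧ ContinuousAt g y := by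
    refine Eventually.and ?_ hg
    have h1 : ∀ᵐ y ∂unitLeb, y ∈ Ioo (0 : ℝ) 1 := ae_restrict_mem measurableSet_Ioo
    have h2 : ∀ᵐ y ∂unitLeb, y ≠ 1 / 2 := ae_restrict_of_ae (Measure.ae_ne volume _)
    filter_upwards [h1, h2] with y hy hy' using ⟨hy.1, hy'⟩
  have hall : ∀ᵐ y ∂ν, ∀ i : ℕ, (0 < (Tmap γ)^[i] y ∧ (Tmap γ)^[i] y ≠ 1 / 2) ∧
      ContinuousAt g ((Tmap γ)^[i] y) :=
    ae_all_iff.2 fun i => (hmp.iterate i).quasiMeasurePreserving.ae (hac.ae_le hgood)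
  filter_upwards [hall] with y hy
  have hit : ∀ i, ContinuousAt ((Tmap γ)^[i]) y := by
    intro i
    induction i with
    | zero => exact continuousAt_id
    | succ i ih =>
      rw [Function.iterate_succ']
      exact (continuousAt_Tmap hγ (hy i).1.1 (hy i).1.2).comp ih
  unfold Sn
  exact tendsto_finsetSum _ fun i _ => (hy (i + 1)).2.comp (hit (i + 1))

lemma exists_code_cover {γ : ℝ} (hγ : γ ∈ Ioo (0 : ℝ) 1) {ν : Measure ℝ} [IsProbabilityMeasure ν]
    (hac : ν ≪ unitLeb) (hinv : ν.map (Tmap γ) = ν) {g : ℝ → ℝ}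
    (hgc : ∀ᵐ y ∂unitLeb, ContinuousAt g y) (hg2 : MemLp g 2 ν) (hg0 : ∫ y, g y ∂ν = 0)
    {η : ℝ} (hη : 0 < η) {θ : ℝ≥0∞} (hθ : 0 < θ) :
    ∃ L : ℕ, 0 < L ∧ ∃ m : ℕ, ∃ s : Set (List ℕ), ν (code (Tmap γ) half m ⁻¹' s) < θ ∧
      ∀ y ∈ Ico (0 : ℝ) 1, η * L ≤ |Sn γ g L y| → code (Tmap γ) half m y ∈ s := by
  obtain ⟨θ', hθ'0, hθ'⟩ := exists_between hθ
  have hmp : MeasurePreserving (Tmap γ) ν ν := ⟨measurable_Tmap γ, hinv⟩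
  obtain ⟨L, hL, hLθ⟩ := exists_measure_birkhoffSum_ge_le (ergodic_Tmap hγ hac hinv)
    (hg2.comp_measurePreserving hmp) (φ := g ∘ Tmap γ)
    (by
      have := integral_map (measurable_Tmap γ).aemeasurable (f := g) (μ := ν)
        (by rw [hinv]; exact hg2.1)
      rw [hinv, hg0] at this
      exact this.symm) hη hθ'0
  have hSn : ∀ y, ∑ i ∈ Finset.range L, (g ∘ Tmap γ) ((Tmap γ)^[i] y) = Sn γ g L y := fun y =>
    Finset.sum_congr rfl fun i _ => by rw [Function.iterate_succ_apply', Function.comp_apply]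
  simp_rw [hSn] at hLθ
  set A := {y | y ∈ Ico (0 : ℝ) 1 ∧ η * L ≤ |Sn γ g L y|} with hA
  set B : ℕ → Set ℝ := fun m => code (Tmap γ) half m ⁻¹' (code (Tmap γ) half m '' A) with hB
  have hBanti : Antitone B := by
    rintro m m' hmm y ⟨y', hy', h⟩
    exact ⟨y', hy', code_eq_iff.2 fun i hi => code_eq_iff.1 h i (hi.trans_le hmm)⟩
  have hlim : Tendsto (fun m => ν (B m)) atTop (𝓝 (ν (⋂ m, B m))) :=
    tendsto_measure_iInter_atTop (fun m => (measurableSet_code_preimage (measurable_Tmap γ)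
      measurable_half m _).nullMeasurableSet) hBanti ⟨0, measure_ne_top _ _⟩
  have hle : ν (⋂ m, B m) ≤ θ' := by
    refine (measure_mono_ae ?_).trans hLθ
    have hX : ∀ᵐ y ∂unitLeb, y ∈ Ioo (0 : ℝ) 1 := ae_restrict_mem measurableSet_Ioo
    filter_upwards [hac.ae_le hX, ae_continuousAt_Sn hγ.1 hac hinv hgc L] with y hy hcont hyB
    choose y' hy' hcode using fun m => mem_iInter.1 hyB m
    have hdist : Tendsto y' atTop (𝓝 y) := by
      rw [tendsto_iff_dist_tendsto_zero]
      refine squeeze_zero' (Eventually.of_forall fun _ => dist_nonneg) ?_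
        (tendsto_expansion_bound hγ.1)
      filter_upwards [eventually_gt_atTop 0] with m hm
      exact dist_le_of_code_eq hγ hm (hy' m).1 (Ioo_subset_Ico_self hy) (hcode m)
    exact ge_of_tendsto' ((hcont.tendsto.comp hdist).abs) fun m => (hy' m).2
  obtain ⟨m, hm⟩ := (hlim.eventually (gt_mem_nhds (hle.trans_lt hθ'))).exists
  exact ⟨L, hL, m, _, hm, fun y hy hy' => ⟨y, ⟨hy, hy'⟩, rfl⟩⟩

lemma half_iterate_of_returnTime_eq_zero {γ y : ℝ} (h : returnTime γ y = 0) (i : ℕ) :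
    half ((Tmap γ)^[i] y) = 0 := by
  have := returnTime_eq_zero_iff.1 h (i + 1) i i.lt_succ_self
  rw [half, if_pos this]

lemma half_iterate_of_returnTime_eq_succ {γ y : ℝ} {k i : ℕ} (h : returnTime γ y = k + 1)
    (hi : i ≤ k) : half ((Tmap γ)^[i] y) = if i = k then 1 else 0 := by
  obtain ⟨h1, h2⟩ := returnTime_eq_succ_iff.1 h
  split_ifs with hik
  · rw [hik, half, if_neg (not_lt.2 h2)]
  · rw [half, if_pos (h1 i (by omega))]

lemma half_iterate_eq_of_code_eq {γ : ℝ} (m : ℕ) {y y' : ℝ}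
    (h : code (inducedMap γ) (returnTime γ) m y = code (inducedMap γ) (returnTime γ) m y') :
    ∀ i < m, half ((Tmap γ)^[i] y) = half ((Tmap γ)^[i] y') := by
  induction m generalizing y y' with
  | zero => simp
  | succ m ih =>
    simp only [code, List.cons.injEq] at h
    obtain ⟨hτ, hcode⟩ := h
    intro i hi
    rcases hk : returnTime γ y with _ | k
    · rw [half_iterate_of_returnTime_eq_zero hk, half_iterate_of_returnTime_eq_zero (hτ ▸ hk)]
    · have hk' : returnTime γ y' = k + 1 := hτ ▸ hk
      rcases le_or_gt i k with hik | hik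
      · rw [half_iterate_of_returnTime_eq_succ hk hik, half_iterate_of_returnTime_eq_succ hk' hik]
      · obtain ⟨j, rfl⟩ := Nat.exists_eq_add_of_lt hik
        have := ih hcode j (by omega)
        rw [inducedMap, inducedMap, hk, hk', ← Function.iterate_add_apply,
          ← Function.iterate_add_apply] at this
        rwa [show k + j + 1 = j + (k + 1) by ring]

lemma half_iterate_eq_of_code_succ_eq {γ : ℝ} {m : ℕ} {y y' : ℝ}
    (h : code (inducedMap γ) (returnTime γ) (m + 1) y =
      code (inducedMap γ) (returnTime γ) (m + 1) y') {i : ℕ} (hi : i < returnTime γ y + m) :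
    half ((Tmap γ)^[i] y) = half ((Tmap γ)^[i] y') := by
  simp only [code, List.cons.injEq] at h
  obtain ⟨hτ, hcode⟩ := h
  rcases hk : returnTime γ y with _ | k
  · rw [half_iterate_of_returnTime_eq_zero hk, half_iterate_of_returnTime_eq_zero (hτ ▸ hk)]
  · have hk' : returnTime γ y' = k + 1 := hτ ▸ hk
    rcases le_or_gt i k with hik | hik
    · rw [half_iterate_of_returnTime_eq_succ hk hik, half_iterate_of_returnTime_eq_succ hk' hik]
    · obtain ⟨j, rfl⟩ := Nat.exists_eq_add_of_lt hik
      have := half_iterate_eq_of_code_eq m hcode j (by omega)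
      rw [inducedMap, inducedMap, hk, hk', ← Function.iterate_add_apply,
        ← Function.iterate_add_apply] at this
      rwa [show k + j + 1 = j + (k + 1) by ring]

/-- The number of visits to `B` of the orbit segment `y, T y, …, T^(n-1) y`. -/
def visits (γ : ℝ) (B : Set ℝ) (n : ℕ) (y : ℝ) : ℝ :=
  ∑ i ∈ Finset.range n, B.indicator (fun _ => 1) ((Tmap γ)^[i] y)

lemma indicator_one_nonneg {α : Type*} (B : Set α) (y : α) :
    0 ≤ B.indicator (fun _ => (1 : ℝ)) y := indicator_nonneg (fun _ _ => zero_le_one) y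

lemma visits_nonneg (γ : ℝ) (B : Set ℝ) (n : ℕ) (y : ℝ) : 0 ≤ visits γ B n y :=
  Finset.sum_nonneg fun _ _ => indicator_one_nonneg B _

lemma visits_le (γ : ℝ) (B : Set ℝ) (n : ℕ) (y : ℝ) : visits γ B n y ≤ n := by
  refine (Finset.sum_le_card_nsmul _ _ 1 fun i _ => ?_).trans (by simp)
  exact indicator_le_self' (fun _ _ => zero_le_one) _

lemma visits_mono (γ : ℝ) (B : Set ℝ) {n n' : ℕ} (h : n ≤ n') (y : ℝ) :
    visits γ B n y ≤ visits γ B n' y :=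
  Finset.sum_le_sum_of_subset_of_nonneg (by simpa using h) fun _ _ _ => indicator_one_nonneg B _

lemma visits_add (γ : ℝ) (B : Set ℝ) (k n : ℕ) (y : ℝ) :
    visits γ B (k + n) y = visits γ B k y + visits γ B n ((Tmap γ)^[k] y) := by
  simp_rw [visits, Finset.sum_range_add, ← Function.iterate_add_apply, add_comm]

lemma measurable_visits (γ : ℝ) {B : Set ℝ} (hB : MeasurableSet B) (n : ℕ) :
    Measurable (visits γ B n) :=
  Finset.measurable_sum _ fun i _ =>
    (measurable_const.indicator hB).comp ((measurable_Tmap γ).iterate i)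

/-- The number of visits to `B` before the first return, cut off at return time `A`. -/
def cutVisits (γ : ℝ) (B : Set ℝ) (A : ℕ) (y : ℝ) : ℝ :=
  if returnTime γ y ≤ A then visits γ B (returnTime γ y) y else 0

lemma cutVisits_nonneg (γ : ℝ) (B : Set ℝ) (A : ℕ) (y : ℝ) : 0 ≤ cutVisits γ B A y := by
  unfold cutVisits
  split_ifs
  · exact visits_nonneg _ _ _ _
  · exact le_rfl

lemma cutVisits_le (γ : ℝ) (B : Set ℝ) (A : ℕ) (y : ℝ) : cutVisits γ B A y ≤ A := by
  unfold cutVisits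
  split_ifs with h
  · exact (visits_le _ _ _ _).trans (by exact_mod_cast h)
  · exact A.cast_nonneg

lemma exists_cutVisits_eq_comp_code (γ : ℝ) (m : ℕ) (s : Set (List ℕ)) (A : ℕ) :
    ∃ u : List ℕ → ℝ, ∀ y, u (code (inducedMap γ) (returnTime γ) (m + 1) y) =
      cutVisits γ (code (Tmap γ) half m ⁻¹' s) A y := by
  suffices hf : (cutVisits γ (code (Tmap γ) half m ⁻¹' s) A).FactorsThrough
      (code (inducedMap γ) (returnTime γ) (m + 1)) from
    ⟨_, fun y => hf.extend_apply (fun _ => 0) y⟩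
  intro y y' h
  have hτ : returnTime γ y = returnTime γ y' := by
    simp only [code, List.cons.injEq] at h
    exact h.1
  rw [cutVisits, cutVisits, ← hτ]
  congr 1
  refine Finset.sum_congr rfl fun i hi => ?_
  have hc : code (Tmap γ) half m ((Tmap γ)^[i] y) = code (Tmap γ) half m ((Tmap γ)^[i] y') := by
    rw [code_eq_iff]
    intro j hj
    rw [← Function.iterate_add_apply, ← Function.iterate_add_apply]
    exact half_iterate_eq_of_code_succ_eq h (by rw [Finset.mem_range] at hi; omega)
  have hmem : (Tmap γ)^[i] y ∈ code (Tmap γ) half m ⁻¹' s ↔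
      (Tmap γ)^[i] y' ∈ code (Tmap γ) half m ⁻¹' s := by rw [mem_preimage, mem_preimage, hc]
  by_cases hy : (Tmap γ)^[i] y' ∈ code (Tmap γ) half m ⁻¹' s
  · rw [indicator_of_mem hy, indicator_of_mem (hmem.2 hy)]
  · rw [indicator_of_notMem hy, indicator_of_notMem (mt hmem.1 hy)]

lemma visits_le_sum_cutVisits (γ : ℝ) (B : Set ℝ) (A n : ℕ) (y : ℝ)
    (h : ∀ j < n, (inducedMap γ)^[j] y ∉ stayLeft γ A) :
    visits γ B n y ≤ ∑ j ∈ Finset.range n, cutVisits γ B A ((inducedMap γ)^[j] y) := by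
  induction n generalizing y with
  | zero => simp [visits]
  | succ n ih =>
    have h0 : y ∉ stayLeft γ A := h 0 n.succ_pos
    have hA : returnTime γ y ≤ A := not_lt.1 fun hlt => h0 (stayLeft_of_le_returnTime hlt)
    have hpos : returnTime γ y ≠ 0 := fun h00 => h0 (returnTime_eq_zero_iff.1 h00 A)
    rw [Finset.sum_range_succ']
    calc visits γ B (n + 1) y ≤ visits γ B (returnTime γ y + n) y :=
          visits_mono γ B (by omega) y
      _ = cutVisits γ B A y + visits γ B n (inducedMap γ y) := by
          rw [visits_add, cutVisits, if_pos hA, inducedMap]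
      _ ≤ _ := by
          rw [add_comm]
          exact add_le_add_left (ih _ fun j hj => h (j + 1) (by omega)) _

lemma lintegral_cutVisits_le {γ : ℝ} (hγ : γ ∈ Ioo (0 : ℝ) 1) {ν : Measure ℝ} [IsFiniteMeasure ν]
    (hac : ν ≪ unitLeb) (hinv : ν.map (Tmap γ) = ν) {B : Set ℝ} (hB : MeasurableSet B) (A : ℕ) :
    ν (Ici (1 / 2)) * ∫⁻ y, ENNReal.ofReal (cutVisits γ B A y) ∂unitLeb ≤ 4 * ν B := by
  refine le_trans (mul_le_mul_right ?_ _) (sum_unitLeb_visits_le hγ hac hinv hB A)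
  have hm : ∀ k, MeasurableSet (stayLeft γ k ∩ (Tmap γ)^[k] ⁻¹' B) := fun k =>
    (measurableSet_stayLeft γ k).inter ((measurable_Tmap γ).iterate k hB)
  calc ∫⁻ y, ENNReal.ofReal (cutVisits γ B A y) ∂unitLeb
      ≤ ∫⁻ y, ∑ k ∈ Finset.range A,
          (stayLeft γ k ∩ (Tmap γ)^[k] ⁻¹' B).indicator 1 y ∂unitLeb := by
        refine lintegral_mono fun y => ?_
        rw [cutVisits]
        split_ifs with h
        · rw [visits, ENNReal.ofReal_sum_of_nonneg fun _ _ => indicator_one_nonneg B _]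
          refine le_trans (Finset.sum_le_sum fun i hi => ?_)
            (Finset.sum_le_sum_of_subset (Finset.range_mono h))
          have hi' : y ∈ stayLeft γ i := stayLeft_of_le_returnTime (Finset.mem_range.1 hi)
          by_cases hb : (Tmap γ)^[i] y ∈ B
          · rw [indicator_of_mem hb, indicator_of_mem (mem_inter hi' hb)]
            simp
          · simp [indicator_of_notMem hb]
        · simp
    _ = _ := by
        rw [lintegral_finsetSum _ fun k _ => measurable_one.indicator (hm k)]
        exact Finset.sum_congr rfl fun k _ => lintegral_indicator_one (hm k)

lemma FlatCone.lintegral_le {γ : ℝ} {Q : Measure ℝ} (hQ : Q ∈ FlatCone γ) (F : ℝ → ℝ≥0∞) :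
    ∫⁻ y, F y ∂Q ≤ 4 * Q univ * ∫⁻ y, F y ∂unitLeb := by
  have h : Q ≤ (4 * Q univ) • unitLeb := Measure.le_iff.2 fun E hE => by
    simpa using FlatCone.apply_le hQ hE
  calc ∫⁻ y, F y ∂Q ≤ ∫⁻ y, F y ∂((4 * Q univ) • unitLeb) := lintegral_mono' h le_rfl
    _ = _ := by rw [lintegral_smul_measure, smul_eq_mul]

lemma unitLeb_iterate_inducedMap_le {γ : ℝ} (hγ : γ ∈ Ioo (0 : ℝ) 1) (j : ℕ) {E : Set ℝ}
    (hE : MeasurableSet E) : unitLeb ((inducedMap γ)^[j] ⁻¹' E) ≤ 4 * unitLeb E := by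
  obtain ⟨Q, hQ, hQe⟩ := exists_lintegral_code_returnTime hγ j (unitLeb_mem_FlatCone hγ.1)
    (fun _ => 1)
  have h1 := hQe 1 measurable_one
  have h2 := hQe (E.indicator 1) (measurable_one.indicator hE)
  have h3 : (fun y => E.indicator (1 : ℝ → ℝ≥0∞) ((inducedMap γ)^[j] y)) =
      ((inducedMap γ)^[j] ⁻¹' E).indicator 1 := by
    ext y
    exact (indicator_comp_right ((inducedMap γ)^[j]) (g := (1 : ℝ → ℝ≥0∞))).symm
  simp only [one_mul, h3, lintegral_indicator_one hE,
    lintegral_indicator_one ((measurable_inducedMap γ).iterate j hE)] at h2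
  simp only [Pi.one_apply, one_mul, lintegral_one, measure_univ] at h1
  rw [h2]
  simpa [← h1] using FlatCone.apply_le hQ hE

lemma lintegral_prod_code_le {γ : ℝ} (hγ : γ ∈ Ioo (0 : ℝ) 1) (M : ℕ) (h : List ℕ → ℝ≥0∞)
    (N : ℕ) {Q : Measure ℝ} (hQ : Q ∈ FlatCone γ) :
    ∫⁻ y, ∏ i ∈ Finset.range N,
        (1 + h (code (inducedMap γ) (returnTime γ) M ((inducedMap γ)^[M * i] y))) ∂Q ≤
      (1 + 4 * ∫⁻ y, h (code (inducedMap γ) (returnTime γ) M y) ∂unitLeb) ^ N * Q univ := by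
  have hmeas : ∀ g : List ℕ → ℝ≥0∞,
      Measurable fun y => g (code (inducedMap γ) (returnTime γ) M y) := fun g =>
    measurable_comp_code (measurable_inducedMap γ) (measurable_returnTime γ) M g
  induction N generalizing Q with
  | zero => simp
  | succ N ih =>
    obtain ⟨Q', hQ', hQe⟩ := exists_lintegral_code_returnTime hγ M hQ (fun l => 1 + h l)
    have hmass : Q' univ ≤
        (1 + 4 * ∫⁻ y, h (code (inducedMap γ) (returnTime γ) M y) ∂unitLeb) * Q univ := by
      have h1 := hQe 1 measurable_one
      simp only [Pi.one_apply, mul_one, lintegral_one] at h1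
      rw [← h1, lintegral_add_left measurable_const, lintegral_one, add_mul, one_mul]
      gcongr
      exact (FlatCone.lintegral_le hQ _).trans_eq (by ring)
    have hmp : Measurable fun y => ∏ i ∈ Finset.range N,
        (1 + h (code (inducedMap γ) (returnTime γ) M ((inducedMap γ)^[M * i] y))) :=
      Finset.measurable_prod _ fun i _ =>
        (hmeas fun l => 1 + h l).comp ((measurable_inducedMap γ).iterate (M * i))
    calc ∫⁻ y, ∏ i ∈ Finset.range (N + 1),
          (1 + h (code (inducedMap γ) (returnTime γ) M ((inducedMap γ)^[M * i] y))) ∂Q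
        = ∫⁻ y, (1 + h (code (inducedMap γ) (returnTime γ) M y)) *
            ∏ i ∈ Finset.range N, (1 + h (code (inducedMap γ) (returnTime γ) M
              ((inducedMap γ)^[M * i] ((inducedMap γ)^[M] y)))) ∂Q := by
          refine lintegral_congr fun y => ?_
          rw [Finset.prod_range_succ', mul_comm]
          simp only [mul_zero, Function.iterate_zero, id, ← Function.iterate_add_apply, mul_add,
            mul_one]
      _ = ∫⁻ y, ∏ i ∈ Finset.range N, (1 + h (code (inducedMap γ) (returnTime γ) M
              ((inducedMap γ)^[M * i] y))) ∂Q' := hQe _ hmp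
      _ ≤ _ := ih hQ'
      _ ≤ _ := by
          rw [pow_succ, mul_assoc]
          gcongr

lemma exp_le_one_add_two_mul {u : ℝ} (h0 : 0 ≤ u) (h1 : u ≤ 1) : Real.exp u ≤ 1 + 2 * u := by
  have h := convexOn_exp.2 (mem_univ 0) (mem_univ 1) (by linarith : 0 ≤ 1 - u) h0 (by ring)
  simp only [smul_eq_mul, mul_zero, mul_one, zero_add, Real.exp_zero] at h
  nlinarith [Real.exp_one_lt_d9]

lemma unitLeb_sum_code_ge_le {γ : ℝ} (hγ : γ ∈ Ioo (0 : ℝ) 1) (M : ℕ) {u : List ℕ → ℝ}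
    (hu : ∀ y, u (code (inducedMap γ) (returnTime γ) M y) ∈ Icc (0 : ℝ) 1) {c : ℝ}
    (hc : ∫⁻ y, ENNReal.ofReal (u (code (inducedMap γ) (returnTime γ) M y)) ∂unitLeb ≤
      ENNReal.ofReal c) (hc0 : 0 ≤ c) (N : ℕ) (t : ℝ) :
    unitLeb {y | t ≤ ∑ i ∈ Finset.range N,
      u (code (inducedMap γ) (returnTime γ) M ((inducedMap γ)^[M * i] y))} ≤
      ENNReal.ofReal (Real.exp (8 * c * N - t)) := by
  set w : ℝ → ℝ := fun y => u (code (inducedMap γ) (returnTime γ) M y) with hw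
  have hwm : Measurable w :=
    measurable_comp_code (measurable_inducedMap γ) (measurable_returnTime γ) M u
  have hsm : Measurable fun y => ∑ i ∈ Finset.range N, w ((inducedMap γ)^[M * i] y) :=
    Finset.measurable_sum _ fun i _ => hwm.comp ((measurable_inducedMap γ).iterate (M * i))
  have hprod := lintegral_prod_code_le hγ M (fun l => ENNReal.ofReal (2 * u l)) N
    (unitLeb_mem_FlatCone hγ.1)
  rw [measure_univ, mul_one] at hprod
  have hexp : ∀ y, ENNReal.ofReal (Real.exp (∑ i ∈ Finset.range N, w ((inducedMap γ)^[M * i] y)))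
      ≤ ∏ i ∈ Finset.range N, (1 + ENNReal.ofReal (2 * w ((inducedMap γ)^[M * i] y))) := by
    intro y
    rw [Real.exp_sum, ENNReal.ofReal_prod_of_nonneg fun _ _ => (Real.exp_pos _).le]
    refine Finset.prod_le_prod' fun i _ => ?_
    have h := hu ((inducedMap γ)^[M * i] y)
    rw [← ENNReal.ofReal_one, ← ENNReal.ofReal_add zero_le_one (by linarith [h.1])]
    exact ENNReal.ofReal_le_ofReal (exp_le_one_add_two_mul h.1 h.2)
  have hbase : 1 + 4 * ∫⁻ y, ENNReal.ofReal (2 * w y) ∂unitLeb ≤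
      ENNReal.ofReal (Real.exp (8 * c)) := by
    have h2 : ∫⁻ y, ENNReal.ofReal (2 * w y) ∂unitLeb ≤ 2 * ENNReal.ofReal c := by
      simp_rw [ENNReal.ofReal_mul zero_le_two]
      rw [lintegral_const_mul _ hwm.ennreal_ofReal]
      simpa using mul_le_mul_right hc 2
    calc 1 + 4 * ∫⁻ y, ENNReal.ofReal (2 * w y) ∂unitLeb
        ≤ 1 + 4 * (2 * ENNReal.ofReal c) := by gcongr
      _ = ENNReal.ofReal (8 * c + 1) := by
          rw [ENNReal.ofReal_add (by positivity) zero_le_one, ENNReal.ofReal_mul (by norm_num),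
            ← mul_assoc, ENNReal.ofReal_one, add_comm]
          norm_num
      _ ≤ _ := ENNReal.ofReal_le_ofReal (Real.add_one_le_exp _)
  have hmark := mul_meas_ge_le_lintegral (μ := unitLeb)
    (hsm.exp.ennreal_ofReal) (ENNReal.ofReal (Real.exp t))
  have hset : {y | t ≤ ∑ i ∈ Finset.range N, w ((inducedMap γ)^[M * i] y)} =
      {y | ENNReal.ofReal (Real.exp t) ≤
        ENNReal.ofReal (Real.exp (∑ i ∈ Finset.range N, w ((inducedMap γ)^[M * i] y)))} := by
    ext y
    simp [ENNReal.ofReal_le_ofReal_iff (Real.exp_pos _).le]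
  rw [← hset] at hmark
  have hle := hmark.trans ((lintegral_mono hexp).trans (hprod.trans (pow_le_pow_left' hbase N)))
  rw [← ENNReal.ofReal_pow (Real.exp_pos _).le, ← Real.exp_nat_mul] at hle
  have hfin : ENNReal.ofReal (Real.exp (-t)) * ENNReal.ofReal (Real.exp t) = 1 := by
    rw [← ENNReal.ofReal_mul (Real.exp_pos _).le, ← Real.exp_add]
    simp
  calc unitLeb {y | t ≤ ∑ i ∈ Finset.range N, w ((inducedMap γ)^[M * i] y)}
      = ENNReal.ofReal (Real.exp (-t)) * (ENNReal.ofReal (Real.exp t) *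
          unitLeb {y | t ≤ ∑ i ∈ Finset.range N, w ((inducedMap γ)^[M * i] y)}) := by
        rw [← mul_assoc, hfin, one_mul]
    _ ≤ ENNReal.ofReal (Real.exp (-t)) * ENNReal.ofReal (Real.exp (N * (8 * c))) := by gcongr
    _ = _ := by
        rw [← ENNReal.ofReal_mul (Real.exp_pos _).le, ← Real.exp_add]
        congr 2
        ring

lemma sum_range_mul_eq (f : ℕ → ℝ) (M N : ℕ) :
    ∑ j ∈ Finset.range (M * N), f j =
      ∑ r ∈ Finset.range M, ∑ i ∈ Finset.range N, f (M * i + r) := by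
  induction N with
  | zero => simp
  | succ N ih =>
    simp_rw [Finset.sum_range_succ _ N, Finset.sum_add_distrib, ← ih, Nat.mul_succ,
      Finset.sum_range_add]

lemma unitLeb_visits_gt_le {γ : ℝ} (hγ : γ ∈ Ioo (0 : ℝ) 1) (m : ℕ) (s : Set (List ℕ)) {A : ℕ}
    (hA : 0 < A) {η κ : ℝ} (hη : 0 < η) (hκ0 : 0 ≤ κ) (hκ1 : 8 * κ ≤ 1) (hκη : 8 * κ ≤ η / 2)
    (hκ : ∫⁻ y, ENNReal.ofReal (cutVisits γ (code (Tmap γ) half m ⁻¹' s) A y) ∂unitLeb ≤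
      ENNReal.ofReal κ) (n : ℕ) :
    unitLeb {y | η * n < visits γ (code (Tmap γ) half m ⁻¹' s) n y} ≤
      4 * n * unitLeb (stayLeft γ A) +
        4 * (m + 1 : ℕ) * ENNReal.ofReal (Real.exp (1 - η / (2 * (m + 1 : ℕ)) * (n / A))) := by
  set B := code (Tmap γ) half m ⁻¹' s with hB
  obtain ⟨u, hu⟩ := exists_cutVisits_eq_comp_code γ m s A
  rw [← hB] at hu
  set M := m + 1 with hM
  have hA0 : (0 : ℝ) < A := by exact_mod_cast hA
  have hM0 : (0 : ℝ) < M := by positivity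
  set N := n / M + 1 with hN
  have hnN : n ≤ M * N := (Nat.lt_mul_div_succ n m.succ_pos).le
  have hNle : (N : ℝ) ≤ n / M + 1 := by
    rw [hN]
    push_cast
    gcongr
    exact Nat.cast_div_le
  have hbound : ∀ y, (A : ℝ)⁻¹ * u (code (inducedMap γ) (returnTime γ) M y) ∈ Icc (0 : ℝ) 1 := by
    intro y
    rw [hu]
    refine ⟨mul_nonneg (by positivity) (cutVisits_nonneg _ _ _ _), ?_⟩
    rw [inv_mul_le_iff₀ hA0, mul_one]
    exact cutVisits_le _ _ _ _
  have hint : ∫⁻ y, ENNReal.ofReal ((A : ℝ)⁻¹ * u (code (inducedMap γ) (returnTime γ) M y))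
      ∂unitLeb ≤ ENNReal.ofReal (κ / A) := by
    have hm : Measurable fun y => ENNReal.ofReal (u (code (inducedMap γ) (returnTime γ) M y)) :=
      measurable_comp_code (measurable_inducedMap γ) (measurable_returnTime γ) M
        fun l => ENNReal.ofReal (u l)
    simp_rw [ENNReal.ofReal_mul (inv_nonneg.2 hA0.le)]
    rw [lintegral_const_mul _ hm, div_eq_inv_mul, ENNReal.ofReal_mul (inv_nonneg.2 hA0.le)]
    simp_rw [hu]
    gcongr
  set t := η * n / (A * M) with ht
  set D := {y | t ≤ ∑ i ∈ Finset.range N,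
    (A : ℝ)⁻¹ * u (code (inducedMap γ) (returnTime γ) M ((inducedMap γ)^[M * i] y))} with hD
  have hDm : MeasurableSet D := measurableSet_le measurable_const
    (Finset.measurable_sum _ fun i _ => (measurable_comp_code (measurable_inducedMap γ)
      (measurable_returnTime γ) M fun l => (A : ℝ)⁻¹ * u l).comp
        ((measurable_inducedMap γ).iterate (M * i)))
  have hDle : unitLeb D ≤ ENNReal.ofReal (Real.exp (1 - η / (2 * M) * (n / A))) := by
    refine (unitLeb_sum_code_ge_le hγ M (u := fun l => (A : ℝ)⁻¹ * u l) hbound hint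
      (by positivity) N t).trans (ENNReal.ofReal_le_ofReal (Real.exp_le_exp.2 ?_))
    have h1 : 8 * (κ / A) * N ≤ 8 * (κ / A) * (n / M) + 8 * (κ / A) := by
      have : 0 ≤ 8 * (κ / A) := by positivity
      nlinarith
    have h2 : 8 * (κ / A) ≤ 1 := by
      rw [← mul_div_assoc, div_le_one hA0]
      exact hκ1.trans (by exact_mod_cast hA)
    have h3 : 8 * (κ / A) * (n / M) ≤ η / (2 * M) * (n / A) := by
      have : 8 * κ * (n / (A * M)) ≤ η / 2 * (n / (A * M)) := by gcongr
      calc 8 * (κ / A) * (n / M) = 8 * κ * (n / (A * M)) := by field_simp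
        _ ≤ _ := this
        _ = _ := by field_simp
    have h4 : t = 2 * (η / (2 * M) * (n / A)) := by
      rw [ht]
      field_simp
    linarith
  have hsub : {y | η * n < visits γ B n y} ⊆
      (⋃ j ∈ Finset.range n, (inducedMap γ)^[j] ⁻¹' stayLeft γ A) ∪
        ⋃ r ∈ Finset.range M, (inducedMap γ)^[r] ⁻¹' D := by
    intro y hy
    by_contra hcon
    simp only [mem_union, mem_iUnion, Finset.mem_range, mem_preimage, not_or, not_exists] at hcon
    obtain ⟨hc1, hc2⟩ := hcon
    have h1 := visits_le_sum_cutVisits γ B A n y hc1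
    have h2 : ∑ j ∈ Finset.range n, cutVisits γ B A ((inducedMap γ)^[j] y) ≤
        ∑ j ∈ Finset.range (M * N), cutVisits γ B A ((inducedMap γ)^[j] y) :=
      Finset.sum_le_sum_of_subset_of_nonneg (Finset.range_mono hnN)
        fun _ _ _ => cutVisits_nonneg _ _ _ _
    rw [sum_range_mul_eq] at h2
    have h3 : ∀ r ∈ Finset.range M, ∑ i ∈ Finset.range N,
        cutVisits γ B A ((inducedMap γ)^[M * i + r] y) ≤ A * t := by
      intro r hr
      have h := hc2 r (Finset.mem_range.1 hr)
      rw [hD, mem_ofPred_eq, not_le, ← Finset.mul_sum, inv_mul_lt_iff₀ hA0] at h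
      simpa only [hu, ← Function.iterate_add_apply] using h.le
    have h4 := Finset.sum_le_card_nsmul _ _ _ h3
    rw [Finset.card_range, nsmul_eq_mul] at h4
    have h5 : (M : ℝ) * (A * t) = η * n := by
      rw [ht]
      field_simp
    have hy' : η * n < visits γ B n y := hy
    linarith
  refine (measure_mono hsub).trans ((measure_union_le _ _).trans (add_le_add ?_ ?_))
  · refine (measure_biUnion_finset_le _ _).trans ((Finset.sum_le_sum fun j _ =>
      unitLeb_iterate_inducedMap_le hγ j (measurableSet_stayLeft γ A)).trans_eq ?_)
    rw [Finset.sum_const, Finset.card_range, nsmul_eq_mul]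
    ring
  · refine (measure_biUnion_finset_le _ _).trans ((Finset.sum_le_sum fun j _ =>
      (unitLeb_iterate_inducedMap_le hγ j hDm).trans (mul_le_mul_right hDle 4)).trans_eq ?_)
    rw [Finset.sum_const, Finset.card_range, nsmul_eq_mul]
    ring

lemma measure_visits_gt_le {γ : ℝ} (hγ : γ ∈ Ioo (0 : ℝ) 1) {ν : Measure ℝ}
    [IsProbabilityMeasure ν] (hac : ν ≪ unitLeb) (hinv : ν.map (Tmap γ) = ν) (m : ℕ)
    (s : Set (List ℕ)) {A : ℕ} (hA : 0 < A) {η κ : ℝ} (hη : 0 < η) (hκ0 : 0 ≤ κ)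
    (hκ1 : 8 * κ ≤ 1) (hκη : 8 * κ ≤ η / 2)
    (hκ : 4 * ν (code (Tmap γ) half m ⁻¹' s) ≤ ν (Ici (1 / 2)) * ENNReal.ofReal κ) {n : ℕ}
    (hAn : A ≤ η * n) :
    ν {y | 2 * η * n < visits γ (code (Tmap γ) half m ⁻¹' s) n y} ≤
      ν (stayLeft γ A) + 4 * (4 * n * unitLeb (stayLeft γ A) +
        4 * (m + 1 : ℕ) * ENNReal.ofReal (Real.exp (1 - η / (2 * (m + 1 : ℕ)) * (n / A)))) := by
  set B := code (Tmap γ) half m ⁻¹' s with hB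
  have hBm : MeasurableSet B := measurableSet_code_preimage (measurable_Tmap γ) measurable_half m s
  have hright : ν (Ici (1 / 2)) ≠ 0 := measure_right_ne_zero hγ hac hinv (by simp)
  have hint : ∫⁻ y, ENNReal.ofReal (cutVisits γ B A y) ∂unitLeb ≤ ENNReal.ofReal κ :=
    (ENNReal.mul_le_mul_iff_right hright (measure_ne_top _ _)).1
      ((lintegral_cutVisits_le hγ hac hinv hBm A).trans hκ)
  have hE : MeasurableSet {y | η * n < visits γ B n y} :=
    measurableSet_lt measurable_const (measurable_visits γ hBm n)
  have hsub : {y | 2 * η * n < visits γ B n y} ⊆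
      stayLeft γ A ∪ inducedMap γ ⁻¹' {y | η * n < visits γ B n y} := by
    intro y hy
    by_contra hcon
    obtain ⟨h0, h1⟩ := not_or.1 hcon
    have hτ : returnTime γ y ≤ A := not_lt.1 fun hlt => h0 (stayLeft_of_le_returnTime hlt)
    have hy' : 2 * η * n < visits γ B n y := hy
    have h2 : visits γ B n (inducedMap γ y) ≤ η * n := not_lt.1 h1
    have h3 : visits γ B n y ≤ visits γ B (returnTime γ y + n) y := visits_mono γ B (by omega) y
    rw [visits_add] at h3
    have h4 : visits γ B (returnTime γ y) y ≤ A :=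
      (visits_le _ _ _ _).trans (by exact_mod_cast hτ)
    have h5 : visits γ B n ((Tmap γ)^[returnTime γ y] y) ≤ η * n := h2
    linarith
  refine (measure_mono hsub).trans ((measure_union_le _ _).trans (add_le_add le_rfl ?_))
  refine (measure_inducedMap_preimage_le hγ hac hinv hE).trans ?_
  rw [measure_univ, mul_one]
  gcongr
  exact unitLeb_visits_gt_le hγ m s hA hη hκ0 hκ1 hκη hint n

lemma exp_one_sub_le_rpow {b δ r : ℝ} (hb : 0 < b) (hδ : 0 < δ) :
    ∃ C : ℝ, 0 < C ∧ ∀ x : ℝ, 1 ≤ x → Real.exp (1 - b * x ^ δ) ≤ C * x ^ r := by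
  obtain ⟨k, hk⟩ := exists_nat_ge (-r / δ)
  refine ⟨Real.exp 1 * (k.factorial / b ^ k), by positivity, fun x hx => ?_⟩
  have hx0 : 0 < x := by linarith
  have hv : 0 < b * x ^ δ := by positivity
  have h1 := Real.pow_div_factorial_le_exp _ hv.le k
  have h2 : x ^ (-(δ * k)) ≤ x ^ r := by
    refine Real.rpow_le_rpow_of_exponent_le hx ?_
    rw [div_le_iff₀ hδ] at hk
    linarith
  have h3 : Real.exp (-(b * x ^ δ)) ≤ k.factorial / b ^ k * x ^ (-(δ * k)) := by
    rw [Real.exp_neg, Real.rpow_neg hx0.le, Real.rpow_mul hx0.le, Real.rpow_natCast]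
    refine (inv_anti₀ (by positivity) h1).trans_eq ?_
    rw [inv_div, mul_pow]
    field_simp
  rw [sub_eq_add_neg, Real.exp_add, mul_assoc]
  gcongr
  exact h3.trans (by gcongr)

lemma exists_measure_visits_gt_le_rpow {γ : ℝ} (hγ : γ ∈ Ioo (0 : ℝ) 1) {ν : Measure ℝ}
    [IsProbabilityMeasure ν] (hac : ν ≪ unitLeb) (hinv : ν.map (Tmap γ) = ν) (m : ℕ)
    (s : Set (List ℕ)) {η κ : ℝ} (hη : 0 < η) (hκ0 : 0 ≤ κ)
    (hκ1 : 8 * κ ≤ 1) (hκη : 8 * κ ≤ η / 2)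
    (hκ : 4 * ν (code (Tmap γ) half m ⁻¹' s) ≤ ν (Ici (1 / 2)) * ENNReal.ofReal κ)
    {ε : ℝ} (hε : 0 < ε) :
    ∃ C : ℝ, 0 < C ∧ ∀ᶠ n : ℕ in atTop,
      ν {y | 2 * η * n < visits γ (code (Tmap γ) half m ⁻¹' s) n y} ≤
        ENNReal.ofReal (C * (n : ℝ) ^ (-(1 - γ) / γ + ε)) := by
  obtain ⟨hγ0, hγ1⟩ := hγ
  set r := -(1 - γ) / γ + ε with hr
  set p := (1 - γ) / γ with hp
  have hp0 : 0 < p := div_pos (by linarith) hγ0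
  have hrp : r = -p + ε := by rw [hr, hp, neg_div]
  set δ := min (ε * γ / 2) (1 / 2) with hδ
  have hδ0 : 0 < δ := lt_min (by positivity) (by norm_num)
  have hδ1 : δ ≤ 1 / 2 := min_le_right _ _
  have hδε : δ ≤ ε * γ / 2 := min_le_left _ _
  have hδγ : δ / γ ≤ ε / 2 := by
    rw [div_le_iff₀ hγ0]
    linarith
  have hδp : δ * p ≤ ε / 2 := by
    refine le_trans ?_ hδγ
    rw [hp, ← mul_div_assoc]
    gcongr
    nlinarith
  obtain ⟨C₁, hC₁, hT₁⟩ := exists_measure_stayLeft_le_rpow ⟨hγ0, hγ1⟩ hac hinv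
    (e := min (ε / 2) p) (lt_min (by positivity) hp0) (min_le_right _ _)
  set e := min (ε / 2) p with he
  have he1 : e ≤ ε / 2 := min_le_left _ _
  have he2 : e ≤ p := min_le_right _ _
  have he0 : 0 < e := lt_min (by positivity) hp0
  set b := η / (2 * (m + 1 : ℕ)) with hb
  have hb0 : 0 < b := by positivity
  obtain ⟨C₃, hC₃, hT₃⟩ := exp_one_sub_le_rpow (b := b / 2) (r := r) (by positivity) hδ0
  set c := (γ / 2) ^ (-(1 / γ)) with hc
  have hc0 : 0 < c := by positivity
  refine ⟨C₁ + 16 * c + 16 * (m + 1 : ℕ) * C₃, by positivity, ?_⟩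
  have hlarge : ∀ᶠ n : ℕ in atTop, 2 / η ≤ (n : ℝ) ^ δ :=
    ((tendsto_rpow_atTop hδ0).comp tendsto_natCast_atTop_atTop).eventually_ge_atTop _
  filter_upwards [hlarge, eventually_ge_atTop 1] with n hn hn1
  have hx1 : (1 : ℝ) ≤ n := by exact_mod_cast hn1
  have hx0 : (0 : ℝ) < n := by linarith
  set A := ⌈(n : ℝ) ^ (1 - δ)⌉₊ with hA
  have hpow1 : 1 ≤ (n : ℝ) ^ (1 - δ) := Real.one_le_rpow hx1 (by linarith)
  have hpow0 : 0 < (n : ℝ) ^ (1 - δ) := by linarith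
  have hAlow : (n : ℝ) ^ (1 - δ) ≤ A := Nat.le_ceil _
  have hAup : (A : ℝ) ≤ 2 * (n : ℝ) ^ (1 - δ) := by
    have := Nat.ceil_lt_add_one hpow0.le
    linarith
  have hA0 : (0 : ℝ) < A := by linarith
  have hA0' : 0 < A := by exact_mod_cast hA0
  have hsplit : (n : ℝ) ^ (1 - δ) * (n : ℝ) ^ δ = n := by
    rw [← Real.rpow_add hx0, sub_add_cancel, Real.rpow_one]
  have hAn : (A : ℝ) ≤ η * n := by
    rw [div_le_iff₀' hη] at hn
    calc (A : ℝ) ≤ 2 * (n : ℝ) ^ (1 - δ) := hAup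
      _ ≤ (η * (n : ℝ) ^ δ) * (n : ℝ) ^ (1 - δ) := by gcongr
      _ = η * n := by rw [mul_assoc, mul_comm ((n : ℝ) ^ δ), hsplit]
  have hB₁ : ν (stayLeft γ A) ≤ ENNReal.ofReal (C₁ * (n : ℝ) ^ r) := by
    refine (hT₁ A hA0').trans (ENNReal.ofReal_le_ofReal ?_)
    gcongr C₁ * ?_
    calc (A : ℝ) ^ (-(1 - γ) / γ + e) ≤ ((n : ℝ) ^ (1 - δ)) ^ (-(1 - γ) / γ + e) := by
          refine Real.rpow_le_rpow_of_nonpos hpow0 hAlow ?_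
          rw [neg_div]
          linarith
      _ = (n : ℝ) ^ ((1 - δ) * (-(1 - γ) / γ + e)) := by rw [← Real.rpow_mul hx0.le]
      _ ≤ (n : ℝ) ^ r := by
          refine Real.rpow_le_rpow_of_exponent_le hx1 ?_
          rw [hrp, neg_div, ← hp]
          nlinarith [mul_pos hδ0 he0]
  have hB₂ : n * unitLeb (stayLeft γ A) ≤ ENNReal.ofReal (c * (n : ℝ) ^ r) := by
    calc n * unitLeb (stayLeft γ A)
        ≤ ENNReal.ofReal n * ENNReal.ofReal ((A * (γ / 2)) ^ (-(1 / γ))) := by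
          rw [ENNReal.ofReal_natCast]
          gcongr
          exact unitLeb_stayLeft_le ⟨hγ0, hγ1⟩ hA0'
      _ = ENNReal.ofReal (n * (A * (γ / 2)) ^ (-(1 / γ))) := (ENNReal.ofReal_mul hx0.le).symm
      _ ≤ _ := by
          refine ENNReal.ofReal_le_ofReal ?_
          rw [Real.mul_rpow hA0.le (by positivity), ← hc, ← mul_assoc, mul_comm]
          gcongr c * ?_
          calc (n : ℝ) * (A : ℝ) ^ (-(1 / γ)) ≤ n * ((n : ℝ) ^ (1 - δ)) ^ (-(1 / γ)) := by
                gcongr n * ?_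
                exact Real.rpow_le_rpow_of_nonpos hpow0 hAlow
                  (neg_nonpos.2 (by positivity))
            _ = (n : ℝ) ^ (1 + (1 - δ) * (-(1 / γ))) := by
                rw [← Real.rpow_mul hx0.le, Real.rpow_add hx0, Real.rpow_one]
            _ ≤ (n : ℝ) ^ r := by
                refine Real.rpow_le_rpow_of_exponent_le hx1 ?_
                have : 1 + (1 - δ) * (-(1 / γ)) = -p + δ / γ := by
                  rw [hp]
                  field_simp
                  ring
                rw [this, hrp]
                linarith
  have hB₃ : ENNReal.ofReal (Real.exp (1 - b * (n / A))) ≤ ENNReal.ofReal (C₃ * (n : ℝ) ^ r) := by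
    refine ENNReal.ofReal_le_ofReal (le_trans (Real.exp_le_exp.2 ?_) (hT₃ n hx1))
    have : (n : ℝ) ^ δ / 2 ≤ n / A := by
      rw [le_div_iff₀ hA0]
      calc (n : ℝ) ^ δ / 2 * A ≤ (n : ℝ) ^ δ / 2 * (2 * (n : ℝ) ^ (1 - δ)) := by gcongr
        _ = (n : ℝ) ^ (1 - δ) * (n : ℝ) ^ δ := by ring
        _ = n := hsplit
    nlinarith
  refine (measure_visits_gt_le ⟨hγ0, hγ1⟩ hac hinv m s hA0' hη hκ0 hκ1 hκη hκ hAn).trans ?_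
  rw [← hb]
  calc ν (stayLeft γ A) + 4 * (4 * n * unitLeb (stayLeft γ A) +
        4 * (m + 1 : ℕ) * ENNReal.ofReal (Real.exp (1 - b * (n / A))))
      = ν (stayLeft γ A) + 16 * (n * unitLeb (stayLeft γ A)) +
        16 * (m + 1 : ℕ) * ENNReal.ofReal (Real.exp (1 - b * (n / A))) := by ring
    _ ≤ ENNReal.ofReal (C₁ * (n : ℝ) ^ r) + 16 * ENNReal.ofReal (c * (n : ℝ) ^ r) +
        16 * (m + 1 : ℕ) * ENNReal.ofReal (C₃ * (n : ℝ) ^ r) := by gcongr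
    _ = _ := by
        have h16 : (16 : ℝ≥0∞) = ENNReal.ofReal 16 := by norm_num
        rw [h16, ← ENNReal.ofReal_natCast (m + 1), ← ENNReal.ofReal_mul (by positivity),
          ← ENNReal.ofReal_mul (by positivity), ← ENNReal.ofReal_mul (by positivity),
          ← ENNReal.ofReal_add (by positivity) (by positivity),
          ← ENNReal.ofReal_add (by positivity) (by positivity)]
        congr 1
        ring

lemma abs_sum_range_mul_le {a : ℕ → ℝ} {K : ℝ} (ha : ∀ k, |a k| ≤ K) (L n : ℕ) :
    L * |∑ i ∈ Finset.range n, a i| ≤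
      ∑ i ∈ Finset.range n, |∑ j ∈ Finset.range L, a (i + j)| + L * (2 * L * K) := by
  have hK : 0 ≤ K := (abs_nonneg _).trans (ha 0)
  have hshift : ∀ j : ℕ,
      |∑ i ∈ Finset.range n, a i - ∑ i ∈ Finset.range n, a (i + j)| ≤ 2 * j * K := by
    intro j
    induction j with
    | zero => simp
    | succ j ih =>
      have h1 : ∑ i ∈ Finset.range n, a (i + (j + 1)) =
          ∑ i ∈ Finset.range n, a (i + j) + a (n + j) - a (0 + j) := by
        rw [← Finset.sum_range_succ (fun i => a (i + j)), Finset.sum_range_succ']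
        simp [add_assoc, add_comm 1 j]
      have h2 := abs_le.1 ih
      have h3 := abs_le.1 (ha (n + j))
      have h4 := abs_le.1 (ha (0 + j))
      rw [h1, abs_le]
      push_cast
      constructor <;> linarith
  have hcomm : ∑ i ∈ Finset.range n, ∑ j ∈ Finset.range L, a (i + j) =
      ∑ j ∈ Finset.range L, ∑ i ∈ Finset.range n, a (i + j) := Finset.sum_comm
  have hdiff : |L * ∑ i ∈ Finset.range n, a i -
      ∑ i ∈ Finset.range n, ∑ j ∈ Finset.range L, a (i + j)| ≤ L * (2 * L * K) := by
    have : (L : ℝ) * ∑ i ∈ Finset.range n, a i =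
        ∑ _j ∈ Finset.range L, ∑ i ∈ Finset.range n, a i := by simp
    rw [hcomm, this, ← Finset.sum_sub_distrib]
    refine (Finset.abs_sum_le_sum_abs _ _).trans
      ((Finset.sum_le_card_nsmul _ _ (2 * L * K) fun j hj => (hshift j).trans ?_).trans_eq ?_)
    · have : (j : ℝ) ≤ L := by exact_mod_cast (Finset.mem_range.1 hj).le
      gcongr
    · simp
  have h := (abs_sub_abs_le_abs_sub _ _).trans hdiff
  rw [abs_mul, Nat.abs_cast] at h
  linarith [Finset.abs_sum_le_sum_abs (fun i => ∑ j ∈ Finset.range L, a (i + j)) (Finset.range n)]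

lemma abs_Sn_le_visits {γ : ℝ} (hγ : 0 < γ) {g : ℝ → ℝ} {K η : ℝ}
    (hK : ∀ y ∈ Ico (0 : ℝ) 1, |g y| ≤ K) {L : ℕ} (hL : 0 < L) {B : Set ℝ} (hη : 0 ≤ η)
    (hB : ∀ y ∈ Ico (0 : ℝ) 1, η * L ≤ |Sn γ g L y| → y ∈ B) (n : ℕ) {y : ℝ}
    (hy : y ∈ Ico (0 : ℝ) 1) :
    |Sn γ g n y| ≤ η * n + K * visits γ B n y + 2 * L * K := by
  have hit := iterate_Tmap_mem_Ico hγ hy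
  have hL0 : (0 : ℝ) < L := by exact_mod_cast hL
  have hSn : ∀ i, ∑ j ∈ Finset.range L, g ((Tmap γ)^[i + j + 1] y) =
      Sn γ g L ((Tmap γ)^[i] y) := fun i => Finset.sum_congr rfl fun j _ => by
    rw [← Function.iterate_add_apply]
    congr 2
    ring
  have h := abs_sum_range_mul_le (a := fun k => g ((Tmap γ)^[k + 1] y)) (fun k => hK _ (hit _)) L n
  simp_rw [hSn] at h
  have hterm : ∀ i, |Sn γ g L ((Tmap γ)^[i] y)| ≤
      L * (η + K * B.indicator (fun _ => 1) ((Tmap γ)^[i] y)) := by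
    intro i
    by_cases hb : (Tmap γ)^[i] y ∈ B
    · have h1 : |Sn γ g L ((Tmap γ)^[i] y)| ≤ L * K := by
        refine (Finset.abs_sum_le_sum_abs _ _).trans
          ((Finset.sum_le_card_nsmul _ _ K fun j _ => hK _ ?_).trans_eq (by simp))
        exact iterate_Tmap_mem_Ico hγ (hit i) _
      rw [indicator_of_mem hb]
      nlinarith
    · rw [indicator_of_notMem hb]
      have := not_le.1 (mt (hB _ (hit i)) hb)
      linarith
  have hsum := Finset.sum_le_sum fun i (_ : i ∈ Finset.range n) => hterm i
  rw [← Finset.mul_sum, Finset.sum_add_distrib, ← Finset.mul_sum] at hsum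
  simp only [Finset.sum_const, Finset.card_range, nsmul_eq_mul] at hsum
  have hfin : L * |Sn γ g n y| ≤ L * (η * n + K * visits γ B n y + 2 * L * K) := by
    refine h.trans ((add_le_add_left hsum _).trans_eq ?_)
    rw [visits]
    ring
  exact le_of_mul_le_mul_left hfin hL0

lemma exists_forall_le_rpow_of_eventually {μ : ℕ → ℝ≥0∞} (hμ : ∀ n, μ n ≤ 1) {r C : ℝ}
    (hC : 0 < C) (h : ∀ᶠ n : ℕ in atTop, μ n ≤ ENNReal.ofReal (C * (n : ℝ) ^ r)) :
    ∃ C' : ℝ, 0 < C' ∧ ∀ n : ℕ, 1 ≤ n → μ n ≤ ENNReal.ofReal (C' * (n : ℝ) ^ r) := by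
  obtain ⟨n₀, hn₀⟩ := eventually_atTop.1 h
  have hS : 0 ≤ ∑ k ∈ Finset.range n₀, (k : ℝ) ^ (-r) :=
    Finset.sum_nonneg fun k _ => by positivity
  refine ⟨C + ∑ k ∈ Finset.range n₀, (k : ℝ) ^ (-r), by positivity, fun n hn => ?_⟩
  have hn0 : (0 : ℝ) < n := by exact_mod_cast hn
  rcases le_or_gt n₀ n with hle | hlt
  · refine (hn₀ n hle).trans (ENNReal.ofReal_le_ofReal ?_)
    gcongr
    linarith
  · refine (hμ n).trans ?_
    rw [← ENNReal.ofReal_one]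
    refine ENNReal.ofReal_le_ofReal ?_
    have h1 : (n : ℝ) ^ (-r) ≤ C + ∑ k ∈ Finset.range n₀, (k : ℝ) ^ (-r) := by
      have := Finset.single_le_sum (f := fun k : ℕ => (k : ℝ) ^ (-r))
        (fun k _ => by positivity) (Finset.mem_range.2 hlt)
      linarith
    calc (1 : ℝ) = (n : ℝ) ^ (-r) * (n : ℝ) ^ r := by
          rw [← Real.rpow_add hn0, neg_add_cancel, Real.rpow_zero]
      _ ≤ _ := by gcongr

theorem exists_measure_abs_Sn_gt_le_rpow {γ : ℝ} (hγ : γ ∈ Ioo (0 : ℝ) 1) {ν : Measure ℝ}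
    [IsProbabilityMeasure ν] (hac : ν ≪ unitLeb) (hinv : ν.map (Tmap γ) = ν) {g : ℝ → ℝ}
    (hgm : Measurable g) (hgc : ∀ᵐ y ∂unitLeb, ContinuousAt g y) {K : ℝ} (hK0 : 0 < K)
    (hK : ∀ y ∈ Ico (0 : ℝ) 1, |g y| ≤ K) (hg0 : ∫ y, g y ∂ν = 0) {ε x : ℝ} (hε : 0 < ε)
    (hx : 0 < x) :
    ∃ C : ℝ, 0 < C ∧ ∀ n : ℕ, 1 ≤ n → ν {y | x < (n : ℝ)⁻¹ * |Sn γ g n y|} ≤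
      ENNReal.ofReal (C * (n : ℝ) ^ (-(1 - γ) / γ + ε)) := by
  have hX : ∀ᵐ y ∂ν, y ∈ Ico (0 : ℝ) 1 := by
    have : ∀ᵐ y ∂unitLeb, y ∈ Ioo (0 : ℝ) 1 := ae_restrict_mem measurableSet_Ioo
    filter_upwards [hac.ae_le this] with y hy using Ioo_subset_Ico_self hy
  have hg2 : MemLp g 2 ν := MemLp.of_bound hgm.aestronglyMeasurable K
    (hX.mono fun y hy => hK y hy)
  set η := x / (4 * K) with hη
  have hη0 : 0 < η := by positivity
  set κ := min 1 (η / 2) / 8 with hκ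
  have hκ0 : 0 < κ := by positivity
  have hκ1 : 8 * κ ≤ 1 := by
    rw [hκ, mul_div_cancel₀ _ (by norm_num)]
    exact min_le_left _ _
  have hκη : 8 * κ ≤ η / 2 := by
    rw [hκ, mul_div_cancel₀ _ (by norm_num)]
    exact min_le_right _ _
  have hright : ν (Ici (1 / 2)) ≠ 0 := measure_right_ne_zero hγ hac hinv (by simp)
  obtain ⟨L, hL, m, s, hs, hcover⟩ := exists_code_cover hγ hac hinv hgc hg2 hg0
    (η := x / 4) (by positivity) (θ := ν (Ici (1 / 2)) * ENNReal.ofReal κ / 4)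
    (ENNReal.div_pos (mul_ne_zero hright (by simpa using hκ0)) (by norm_num))
  have hs' : 4 * ν (code (Tmap γ) half m ⁻¹' s) ≤ ν (Ici (1 / 2)) * ENNReal.ofReal κ := by
    rw [mul_comm]
    exact (ENNReal.le_div_iff_mul_le (by simp) (by simp)).1 hs.le
  obtain ⟨C, hC, hev⟩ := exists_measure_visits_gt_le_rpow hγ hac hinv m s hη0 hκ0.le hκ1 hκη hs' hε
  refine exists_forall_le_rpow_of_eventually (fun n => prob_le_one) hC ?_
  have hlarge : ∀ᶠ n : ℕ in atTop, 2 * L * K / (x / 4) ≤ n :=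
    tendsto_natCast_atTop_atTop.eventually_ge_atTop _
  filter_upwards [hev, hlarge, eventually_ge_atTop 1] with n hn hnL hn1
  refine (measure_mono_ae ?_).trans hn
  filter_upwards [hX] with y hy hyS
  have hn0 : (0 : ℝ) < n := by exact_mod_cast hn1
  have h1 : x < (n : ℝ)⁻¹ * |Sn γ g n y| := hyS
  rw [inv_mul_eq_div, lt_div_iff₀ hn0] at h1
  rw [div_le_iff₀ (by positivity)] at hnL
  have h2 := abs_Sn_le_visits hγ.1 hK hL (B := code (Tmap γ) half m ⁻¹' s) (by positivity) hcover
    n hy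
  have h3 : K * (2 * η * n) < K * visits γ (code (Tmap γ) half m ⁻¹' s) n y := by
    have : K * (2 * η * n) = x * n / 2 := by
      rw [hη]
      field_simp
      ring
    linarith
  exact lt_of_mul_lt_mul_left h3 hK0.le

end Intermittent
/-- deviation bound for BV functions: for `γ ∈ (0,1)` and
`f` of bounded variation on `[0,1]`, for every `ε > 0` and `x > 0` there is
`C(x) > 0` with `ν_γ(n^{-1}|S_n(f−ν_γ(f))| > x) ≤ C(x) n^{−(1−γ)/γ+ε}` for all
`n ≥ 1`. -/
theorem statement18 (γ : ℝ) (hγ : γ ∈ Set.Ioo (0:ℝ) 1)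
    (ν : Measure ℝ) [IsProbabilityMeasure ν] (hsupp : ν (Set.Icc 0 1) = 1)
    (hac : ν ≪ MeasureTheory.volume) (hinv : Measure.map (Tmap γ) ν = ν)
    (f : ℝ → ℝ) (hfm : Measurable f)
    (hBV : BoundedVariationOn f (Set.Icc 0 1)) :
    ∀ ε : ℝ, 0 < ε → ∀ x : ℝ, 0 < x →
      ∃ C : ℝ, 0 < C ∧ ∀ n : ℕ, 1 ≤ n →
        ν {y | x < (n : ℝ)⁻¹ * |Sn γ (fun z => f z - ∫ w, f w ∂ν) n y|}
          ≤ ENNReal.ofReal (C * (n : ℝ) ^ (-(1 - γ)/γ + ε)) := by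
  have hIoo : ∀ᵐ y ∂ν, y ∈ Set.Ioo (0 : ℝ) 1 := by
    have hIcc : ∀ᵐ y ∂ν, y ∈ Set.Icc (0 : ℝ) 1 :=
      (mem_ae_iff_prob_eq_one measurableSet_Icc).2 hsupp
    filter_upwards [hIcc, hac.ae_le (Measure.ae_ne volume (0 : ℝ)),
      hac.ae_le (Measure.ae_ne volume (1 : ℝ))] with y hy h0 h1
    exact ⟨lt_of_le_of_ne hy.1 (Ne.symm h0), lt_of_le_of_ne hy.2 h1⟩
  have hac' : ν ≪ Intermittent.unitLeb := by
    rw [← Measure.restrict_eq_self_of_ae_mem hIoo]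
    exact hac.restrict _
  set I := ∫ w, f w ∂ν with hI
  set V := (eVariationOn f (Set.Icc 0 1)).toReal with hV
  have hfb : ∀ y ∈ Set.Icc (0 : ℝ) 1, |f y| ≤ |f 0| + V := by
    intro y hy
    have h1 := hBV.dist_le hy (Set.left_mem_Icc.2 zero_le_one)
    rw [Real.dist_eq, ← hV] at h1
    have h2 := abs_add_le (f y - f 0) (f 0)
    rw [sub_add_cancel] at h2
    linarith
  have hV0 : 0 ≤ V := ENNReal.toReal_nonneg
  have hfi : Integrable f ν := Integrable.of_bound hfm.aestronglyMeasurable (|f 0| + V)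
    (hIoo.mono fun y hy => hfb y (Set.Ioo_subset_Icc_self hy))
  have hcont : ∀ᵐ y ∂Intermittent.unitLeb, ContinuousAt (fun z => f z - I) y := by
    have hmem : ∀ᵐ y ∂Intermittent.unitLeb, y ∈ Set.Ioo (0 : ℝ) 1 :=
      ae_restrict_mem measurableSet_Ioo
    have hdiff : ∀ᵐ y ∂Intermittent.unitLeb, y ∈ Set.Icc (0 : ℝ) 1 →
        DifferentiableWithinAt ℝ f (Set.Icc 0 1) y :=
      ae_restrict_of_ae hBV.locallyBoundedVariationOn.ae_differentiableWithinAt_of_mem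
    filter_upwards [hmem, hdiff] with y hy hd
    exact ((hd (Set.Ioo_subset_Icc_self hy)).continuousWithinAt.continuousAt
      (Icc_mem_nhds hy.1 hy.2)).sub continuousAt_const
  intro ε hε x hx
  refine Intermittent.exists_measure_abs_Sn_gt_le_rpow hγ hac' hinv (hfm.sub_const I) hcont
    (K := |f 0| + V + |I| + 1) (by positivity) (fun y hy => ?_) ?_ hε hx
  · linarith [abs_sub (f y) I, hfb y (Set.Ico_subset_Icc_self hy)]
  · rw [integral_sub hfi (integrable_const I)]
    simp [hI]

end
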